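/- arXiv:math/0210079 — 2 statements merged into one kernel-verified Lean document; each statement's English description precedes it below -/
import Mathlib

section
/- Let k be an infinite field, I a homogeneous ideal of S = k[x_1,…,x_n], and gin(I) the generic initial ideal of I with respect to the reverse lexicographic order. Then r(S/I) = r(S/gin(I)). -/
set_option synthInstance.maxHeartbeats 1000000
set_option maxHeartbeats 1000000

/-! Common definitions: gradings, term orders, initial ideals, generic initial ideals,
Borel-fixed ideals, filter-regular sequences, a Koszul/Čech-type description of graded
local cohomology and the invariants `a_i`, `reg_t`, `a*_t`, minimal graded free
resolutions, and reductions. -/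

namespace Paper

open MvPolynomial

noncomputable section

variable {k : Type*} [Field k] {n : ℕ}

/-- Total degree of an exponent vector. -/
def adeg (a : Fin n →₀ ℕ) : ℕ := ∑ j, a j

/-- `m(x^A)` : the largest (1-based) index `i` such that `xᵢ` divides `x^A`. -/
def mval (a : Fin n →₀ ℕ) : ℕ := a.support.sup fun j => (j : ℕ) + 1

/-- The degree-`d` homogeneous piece of the polynomial ring (`⊥` in negative degrees). -/
def sPiece (k : Type*) [Field k] (n : ℕ) (d : ℤ) : Submodule k (MvPolynomial (Fin n) k) :=
  if 0 ≤ d then homogeneousSubmodule (Fin n) k d.toNat else ⊥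

/-- `I` is a homogeneous (graded) ideal. -/
def IsHomog (I : Ideal (MvPolynomial (Fin n) k)) : Prop :=
  ∀ f ∈ I, ∀ d : ℕ, homogeneousComponent d f ∈ I

/-- Degree reverse lexicographic order with `x₁ > x₂ > ⋯ > xₙ` : `a < b`. -/
def drlt (a b : Fin n →₀ ℕ) : Prop :=
  adeg a < adeg b ∨
    (adeg a = adeg b ∧ ∃ i : Fin n, b i < a i ∧ ∀ j : Fin n, i < j → a j = b j)

/-- Lexicographic order with `x₁ > x₂ > ⋯ > xₙ` : `a < b`. -/
def lexlt (a b : Fin n →₀ ℕ) : Prop :=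
  ∃ i : Fin n, a i < b i ∧ ∀ j : Fin n, j < i → a j = b j

/-- An abstract term order on monomials in `n` variables. -/
structure TermOrder (n : ℕ) where
  lt : (Fin n →₀ ℕ) → (Fin n →₀ ℕ) → Prop
  irrefl : ∀ a, ¬ lt a a
  trans : ∀ a b c, lt a b → lt b c → lt a c
  total : ∀ a b, a ≠ b → lt a b ∨ lt b a
  add_right : ∀ a b c, lt a b → lt (a + c) (b + c)
  zero_bot : ∀ a, a ≠ 0 → lt 0 a

/-- `a` is the leading exponent of `f` with respect to the term order `lt`. -/
def IsLeadExp (lt : (Fin n →₀ ℕ) → (Fin n →₀ ℕ) → Prop)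
    (f : MvPolynomial (Fin n) k) (a : Fin n →₀ ℕ) : Prop :=
  a ∈ f.support ∧ ∀ b ∈ f.support, b ≠ a → lt b a

/-- The initial ideal of `I` with respect to the term order `lt`. -/
def inIdealW (lt : (Fin n →₀ ℕ) → (Fin n →₀ ℕ) → Prop)
    (I : Ideal (MvPolynomial (Fin n) k)) : Ideal (MvPolynomial (Fin n) k) :=
  Ideal.span {m | ∃ f a, f ∈ I ∧ IsLeadExp lt f a ∧ m = monomial a (1 : k)}

/-- The initial ideal with respect to the (degree) reverse lexicographic order. -/
def inIdeal (I : Ideal (MvPolynomial (Fin n) k)) : Ideal (MvPolynomial (Fin n) k) :=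
  inIdealW drlt I

/-- The linear change of coordinates associated to a matrix `g`, `xⱼ ↦ ∑ᵢ gᵢⱼ xᵢ`. -/
def act (g : Matrix (Fin n) (Fin n) k) :
    MvPolynomial (Fin n) k →ₐ[k] MvPolynomial (Fin n) k :=
  aeval fun j => ∑ i, C (g i j) * X i

/-- The image of the ideal `I` under the linear change of coordinates `g`. -/
def actI (g : Matrix (Fin n) (Fin n) k) (I : Ideal (MvPolynomial (Fin n) k)) :
    Ideal (MvPolynomial (Fin n) k) :=
  Ideal.map (act g) I

/-- `J` is the generic initial ideal of `I` w.r.t. the term order `lt`: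
there is a nonempty Zariski-open subset `U ⊆ GL(n,k)` with `in(g I) = J` for all `g ∈ U`. -/
def IsGinW (lt : (Fin n →₀ ℕ) → (Fin n →₀ ℕ) → Prop)
    (I J : Ideal (MvPolynomial (Fin n) k)) : Prop :=
  ∃ U : Set (Matrix (Fin n) (Fin n) k), U.Nonempty ∧
    (∃ P : Set (MvPolynomial (Fin n × Fin n) k),
      U = {g | IsUnit g.det ∧ ∃ p ∈ P, MvPolynomial.eval (fun q => g q.1 q.2) p ≠ 0}) ∧
    ∀ g ∈ U, inIdealW lt (actI g I) = J

/-- Generic initial ideal with respect to the reverse lexicographic order. -/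
def IsGin (I J : Ideal (MvPolynomial (Fin n) k)) : Prop := IsGinW drlt I J

/-- `I` is a monomial ideal. -/
def IsMonomialIdeal (I : Ideal (MvPolynomial (Fin n) k)) : Prop :=
  ∃ A : Set (Fin n →₀ ℕ), I = Ideal.span ((fun a => (monomial a (1 : k))) '' A)

/-- The maximal graded ideal `𝔐 = (x₁, …, xₙ)` of the polynomial ring. -/
def maxIdeal (k : Type*) [Field k] (n : ℕ) : Ideal (MvPolynomial (Fin n) k) :=
  Ideal.span (Set.range X)

/-- `x^a` is a minimal (monomial) generator of the monomial ideal `I`. -/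
def IsMinGen (I : Ideal (MvPolynomial (Fin n) k)) (a : Fin n →₀ ℕ) : Prop :=
  monomial a (1 : k) ∈ I ∧ monomial a (1 : k) ∉ maxIdeal k n * I

def IsUpperTriangular (g : Matrix (Fin n) (Fin n) k) : Prop :=
  ∀ i j : Fin n, j < i → g i j = 0

/-- `I` is Borel-fixed: fixed by every invertible upper triangular change of coordinates. -/
def IsBorelFixed (I : Ideal (MvPolynomial (Fin n) k)) : Prop :=
  ∀ g : Matrix (Fin n) (Fin n) k, IsUnit g.det → IsUpperTriangular g → actI g I = I

/-- Degree-`d` piece of the standard grading on `S/I` (for `I` homogeneous). -/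
def qPiece (I : Ideal (MvPolynomial (Fin n) k)) (d : ℤ) :
    Submodule k (MvPolynomial (Fin n) k ⧸ I) :=
  (sPiece k n d).map (Ideal.Quotient.mkₐ k I).toLinearMap

/-- Degree-`d` piece of the standard grading on the ideal `I` viewed as a module. -/
def iPiece (I : Ideal (MvPolynomial (Fin n) k)) (d : ℤ) : Submodule k ↥I :=
  (sPiece k n d).comap ((I.subtype).restrictScalars k)

/-- The maximal graded ideal of `S/I`. -/
def maxIdealQ (I : Ideal (MvPolynomial (Fin n) k)) : Ideal (MvPolynomial (Fin n) k ⧸ I) :=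
  (maxIdeal k n).map (Ideal.Quotient.mk I)

/-- `z 0, …, z (s-1)` is a filter-regular sequence in `R` (with maximal graded ideal `mR`):
`z i` avoids all associated primes `≠ mR` of `(z 0, …, z (i-1))`. -/
def FilterRegular {R : Type*} [CommRing R] (mR : Ideal R) (z : ℕ → R) (s : ℕ) : Prop :=
  ∀ i < s, ∀ p ∈ associatedPrimes R (R ⧸ Ideal.span {x | ∃ j < i, x = z j}),
    p ≠ mR → z i ∉ p

/-- The sequence `xₙ, xₙ₋₁, …, x₁` in `S/I` (extended by `0`). -/
def revVars (I : Ideal (MvPolynomial (Fin n) k)) (j : ℕ) :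
    MvPolynomial (Fin n) k ⧸ I :=
  if h : j < n then Ideal.Quotient.mk I (X ⟨n - 1 - j, by omega⟩) else 0

section LC

variable {M : Type*} [AddCommGroup M]

/-- `i`-cochains of the stable Koszul (Čech) complex on the variables. -/
abbrev Koch (n : ℕ) (M : Type*) (i : ℕ) : Type _ :=
  {T : Finset (Fin n) // T.card = i} → M

/-- The differential (into cohomological degree `i`) of the Koszul complex
on `x₁ᵗ, …, xₙᵗ` with coefficients in `M`. -/
def kdelta [Module (MvPolynomial (Fin n) k) M] (t i : ℕ)
    (v : Koch n M (i - 1)) : Koch n M i := fun T =>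
  ∑ j ∈ T.1.attach,
    ((-1 : ℤ) ^ ((T.1.filter (fun l => l < j.1)).card)) •
      ((X j.1 ^ t : MvPolynomial (Fin n) k) •
        v ⟨T.1.erase j.1, by rw [Finset.card_erase_of_mem j.2, T.2]⟩)

/-- The transition map from the Koszul complex at level `t` to the one at level `t+1`. -/
def ktrans [Module (MvPolynomial (Fin n) k) M] (i : ℕ) (v : Koch n M i) : Koch n M i :=
  fun T => ((∏ j ∈ T.1, X j : MvPolynomial (Fin n) k)) • v T

/-- The cochain `v` lies in the degree-`d` strand (for the grading `ℳ` of `M`,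
where the Koszul generators at level `t` have degree `t`). -/
def strand [Module k M] (ℳ : ℤ → Submodule k M) (t i : ℕ) (d : ℤ)
    (v : Koch n M i) : Prop :=
  ∀ T, v T ∈ ℳ (d + (t : ℤ) * (i : ℤ))

/-- `H^i_𝔐(M)_d ≠ 0` : the degree-`d` strand of `i`-th local cohomology (computed as the
direct limit over `t` of the Koszul cohomology on `x₁ᵗ, …, xₙᵗ`) is nonzero. -/
def lcNonvanish (n : ℕ) [Module k M] [Module (MvPolynomial (Fin n) k) M]
    (ℳ : ℤ → Submodule k M) (i : ℕ) (d : ℤ) : Prop :=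
  ∃ (t : ℕ) (v : Koch n M i),
    strand ℳ t i d v ∧ kdelta (k := k) t (i + 1) v = 0 ∧
    ∀ s : ℕ, ¬ ∃ w : Koch n M (i - 1),
      strand ℳ (t + s) (i - 1) d w ∧
        kdelta (k := k) (t + s) i w = (ktrans (k := k) i)^[s] v

open Classical in
/-- `a_i(M)` : the largest degree `d` with `H^i_𝔐(M)_d ≠ 0` (`⊥` if `H^i_𝔐(M) = 0`). -/
def aDeg (n : ℕ) [Module k M] [Module (MvPolynomial (Fin n) k) M]
    (ℳ : ℤ → Submodule k M) (i : ℕ) : WithBot ℤ :=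
  if (∃ d : ℤ, lcNonvanish n ℳ i d) then
    ((sSup {d : ℤ | lcNonvanish n ℳ i d} : ℤ) : WithBot ℤ)
  else ⊥

/-- `reg_t(M) = max{a_i(M) + i : i ≤ t}`. -/
def regT (n : ℕ) [Module k M] [Module (MvPolynomial (Fin n) k) M]
    (ℳ : ℤ → Submodule k M) (t : ℕ) : WithBot ℤ :=
  (Finset.range (t + 1)).sup fun i => aDeg n ℳ i + ((i : ℤ) : WithBot ℤ)

/-- `a*_t(M) = max{a_i(M) : i ≤ t}`. -/
def aStarT (n : ℕ) [Module k M] [Module (MvPolynomial (Fin n) k) M]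
    (ℳ : ℤ → Submodule k M) (t : ℕ) : WithBot ℤ :=
  (Finset.range (t + 1)).sup fun i => aDeg n ℳ i

end LC

open Classical in
/-- Supremum of a set of integers, as an element of `WithBot ℤ` (`⊥` for the empty set). -/
def zSupBot (A : Set ℤ) : WithBot ℤ :=
  if A.Nonempty then ((sSup A : ℤ) : WithBot ℤ) else ⊥

section Res

variable (k) (n)
variable (M : Type*) [AddCommGroup M] [Module k M]
  [Module (MvPolynomial (Fin n) k) M]

/-- A minimal graded free resolution `0 → F_len → ⋯ → F_1 → F_0 → M` of the graded
module `M` (with grading `ℳ`): `F i` is free with basis elements of degrees `tw i j`,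
the maps are degree-preserving, the complex is exact, and all differentials map into
`𝔐 ⬝ F i` (minimality). -/
structure MGFR (ℳ : ℤ → Submodule k M) where
  len : ℕ
  rk : ℕ → ℕ
  tw : (i : ℕ) → Fin (rk i) → ℤ
  rk_top : ∀ i, len < i → rk i = 0
  aug : (Fin (rk 0) → MvPolynomial (Fin n) k) →ₗ[MvPolynomial (Fin n) k] M
  diff : (i : ℕ) → ((Fin (rk (i + 1)) → MvPolynomial (Fin n) k)
      →ₗ[MvPolynomial (Fin n) k] (Fin (rk i) → MvPolynomial (Fin n) k))
  aug_surj : Function.Surjective aug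
  exact_zero : LinearMap.ker aug = LinearMap.range (diff 0)
  exact_succ : ∀ i, LinearMap.ker (diff i) = LinearMap.range (diff (i + 1))
  graded_aug : ∀ (d : ℤ) (v : Fin (rk 0) → MvPolynomial (Fin n) k),
    (∀ j, v j ∈ sPiece k n (d - tw 0 j)) → aug v ∈ ℳ d
  graded_diff : ∀ (i : ℕ) (d : ℤ) (v : Fin (rk (i + 1)) → MvPolynomial (Fin n) k),
    (∀ j, v j ∈ sPiece k n (d - tw (i + 1) j)) → ∀ j, diff i v j ∈ sPiece k n (d - tw i j)
  minimal : ∀ i, LinearMap.range (diff i) ≤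
    (maxIdeal k n) • (⊤ : Submodule (MvPolynomial (Fin n) k)
      (Fin (rk i) → MvPolynomial (Fin n) k))

variable {k n M} {ℳ : ℤ → Submodule k M}

/-- `b_i` : the maximum degree of the generators of `F_i` (`⊥` if `F_i = 0`). -/
def bdeg (res : MGFR k n M ℳ) (i : ℕ) : WithBot ℤ :=
  Finset.univ.sup fun j : Fin (res.rk i) => ((res.tw i j : ℤ) : WithBot ℤ)

/-- The `j`-th syzygy module of `M`, as a submodule of `F_j`. -/
def syzSub (res : MGFR k n M ℳ) : (j : ℕ) →
    Submodule (MvPolynomial (Fin n) k) (Fin (res.rk j) → MvPolynomial (Fin n) k)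
  | 0 => LinearMap.ker res.aug
  | (m + 1) => LinearMap.ker (res.diff m)

/-- The degree-`d` piece of the induced grading on the `j`-th syzygy module. -/
def syzPiece (res : MGFR k n M ℳ) (j : ℕ) (d : ℤ) :
    Submodule k ↥(syzSub res j) :=
  Submodule.comap ((syzSub res j).subtype.restrictScalars k)
    (Submodule.pi Set.univ fun l => sPiece k n (d - res.tw j l))

/-- The dual (transposed) differential, into cohomological degree `i`,
of the complex `Hom(F_•, S)` computing `Ext^•(M, S)`. -/
def extDiffInto (res : MGFR k n M ℳ) : (i : ℕ) →
    (Fin (res.rk (i - 1)) → MvPolynomial (Fin n) k) →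
      (Fin (res.rk i) → MvPolynomial (Fin n) k)
  | 0 => fun _ => 0
  | (m + 1) => fun u j' => ∑ j, res.diff m (Pi.single j' 1) j * u j

/-- `Ext^i_S(M, S)_r ≠ 0`, computed from the given minimal graded free resolution;
the dual basis element of a generator of degree `tw i j` has degree `-tw i j`. -/
def ExtNonzero (res : MGFR k n M ℳ) (i : ℕ) (r : ℤ) : Prop :=
  ∃ u : Fin (res.rk i) → MvPolynomial (Fin n) k,
    (∀ j, u j ∈ sPiece k n (r + res.tw i j)) ∧
    extDiffInto res (i + 1) u = 0 ∧
    ¬ ∃ w : Fin (res.rk (i - 1)) → MvPolynomial (Fin n) k, extDiffInto res i w = u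

end Res

section Red

variable {R : Type*} [CommRing R]

/-- `a` is a reduction of the ideal `mR` : `mR^(r+1) = a * mR^r` for all large `r`. -/
def IsReduction (mR a : Ideal R) : Prop :=
  a ≤ mR ∧ ∃ N, ∀ r ≥ N, mR ^ (r + 1) = a * mR ^ r

/-- `a` is a minimal reduction of `mR`. -/
def IsMinimalReduction (mR a : Ideal R) : Prop :=
  IsReduction mR a ∧ ∀ b, IsReduction mR b → b ≤ a → b = a

/-- The reduction number `r_a` : the least `r` with `mR^(r+1) = a * mR^r`. -/
def redNum (mR a : Ideal R) : ℕ := sInf {r | mR ^ (r + 1) = a * mR ^ r}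

/-- The reduction number: the minimum of `r_a` over all minimal reductions `a` of `mR`. -/
def ringRedNum (mR : Ideal R) : ℕ :=
  sInf {r | ∃ a, IsMinimalReduction mR a ∧ redNum mR a = r}

end Red

section AbstractRed

variable {k : Type*} [Field k] {R : Type*} [CommRing R] [Algebra k R]

theorem span_mul_sub (A B : Submodule k R) :
    Ideal.span ((A * B : Submodule k R) : Set R) = Ideal.span (A : Set R) * Ideal.span (B : Set R) := by
  apply le_antisymm
  · rw [Ideal.span_le]
    intro x hx
    induction hx using Submodule.mul_induction_on' with
    | mem_mul_mem a ha b hb => exact Ideal.mul_mem_mul (Ideal.subset_span ha) (Ideal.subset_span hb)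
    | add x _ y _ hx hy => exact add_mem hx hy
  · rw [Ideal.span_mul_span', Ideal.span_le]
    rintro _ ⟨a, ha, b, hb, rfl⟩
    exact Ideal.subset_span (Submodule.mul_mem_mul ha hb)

theorem span_pow_sub (V : Submodule k R) (r : ℕ) :
    Ideal.span ((V ^ r : Submodule k R) : Set R) = Ideal.span (V : Set R) ^ r := by
  induction r with
  | zero =>
    rw [pow_zero, pow_zero, Ideal.one_eq_top, Ideal.eq_top_iff_one]
    exact Ideal.subset_span (Submodule.one_le.mp le_rfl)
  | succ r ih => rw [pow_succ, pow_succ, span_mul_sub, ih]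

/-- The abstract standard graded algebra hypotheses. -/
structure StdGr (V : Submodule k R) : Prop where
  fin : FiniteDimensional k V
  gen : ∀ x : R, ∃ c : k, x - algebraMap k R c ∈ Ideal.span (V : Set R)
  adj : Algebra.adjoin k (V : Set R) = ⊤
  gr : ∀ r, ∀ x ∈ V ^ r, x ∈ Ideal.span (V : Set R) ^ (r + 1) → x = 0

variable {V : Submodule k R}

theorem StdGr.lead (h : StdGr V) {r : ℕ} {x : R} (hx : x ∈ Ideal.span (V : Set R) ^ r) :
    ∃ y ∈ V ^ r, x - y ∈ Ideal.span (V : Set R) ^ (r + 1) := by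
  rw [← span_pow_sub] at hx
  induction hx using Submodule.span_induction with
  | mem x hx => exact ⟨x, hx, by simp⟩
  | zero => exact ⟨0, zero_mem _, by simp⟩
  | add x y _ _ hx hy =>
    obtain ⟨a, ha, ha'⟩ := hx
    obtain ⟨b, hb, hb'⟩ := hy
    exact ⟨a + b, add_mem ha hb, by convert add_mem ha' hb' using 1; ring⟩
  | smul a x hx ih =>
    obtain ⟨b, hb, hb'⟩ := ih
    obtain ⟨c, hc⟩ := h.gen a
    refine ⟨c • b, Submodule.smul_mem _ _ hb, ?_⟩
    have hx' : x ∈ Ideal.span (V : Set R) ^ r := by rw [← span_pow_sub]; exact hx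
    have e : a • x - c • b = (a - algebraMap k R c) * x + algebraMap k R c * (x - b) := by
      rw [Algebra.smul_def c b, smul_eq_mul]; ring
    rw [e]
    refine add_mem ?_ (Ideal.mul_mem_left _ _ hb')
    rw [pow_succ']
    exact Ideal.mul_mem_mul hc hx'

/-- the subspace of initial linear forms of an ideal -/
def linPart (V : Submodule k R) (a : Ideal R) : Submodule k R :=
  V ⊓ ((a ⊔ Ideal.span (V : Set R) ^ 2).restrictScalars k)

theorem StdGr.linPart_red (h : StdGr V) {a : Ideal R} (ha : a ≤ Ideal.span (V : Set R)) {r : ℕ}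
    (hr : Ideal.span (V : Set R) ^ (r + 1) = a * Ideal.span (V : Set R) ^ r) :
    V ^ (r + 1) ≤ linPart V a * V ^ r := by
  set m := Ideal.span (V : Set R) with hm
  have key : ∀ x ∈ a * m ^ r, ∃ y ∈ linPart V a * V ^ r, x - y ∈ m ^ (r + 2) := by
    intro x hx
    induction hx using Submodule.mul_induction_on' with
    | mem_mul_mem u hu v hv =>
      obtain ⟨l, hl, hl'⟩ := h.lead (r := 1) (x := u) (by rw [pow_one]; exact ha hu)
      obtain ⟨w, hw, hw'⟩ := h.lead hv
      rw [pow_one] at hl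
      refine ⟨l * w, Submodule.mul_mem_mul ⟨hl, ?_⟩ hw, ?_⟩
      · have : l = u - (u - l) := by ring
        rw [this]
        exact sub_mem (Ideal.mem_sup_left hu) (Ideal.mem_sup_right hl')
      · have e : u * v - l * w = (u - l) * v + l * (v - w) := by ring
        rw [e]
        refine add_mem ?_ ?_
        · have := Ideal.mul_mem_mul hl' hv
          rw [← pow_add] at this
          convert this using 2; omega
        · have := Ideal.mul_mem_mul (Ideal.subset_span hl : l ∈ m) hw'
          rw [← pow_succ'] at this
          exact this
    | add x _ y _ hx hy =>
      obtain ⟨a, ha, ha'⟩ := hx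
      obtain ⟨b, hb, hb'⟩ := hy
      exact ⟨a + b, add_mem ha hb, by convert add_mem ha' hb' using 1; ring⟩
  intro x hx
  have hx' : x ∈ m ^ (r + 1) := by rw [hm, ← span_pow_sub]; exact Ideal.subset_span hx
  obtain ⟨y, hy, hy'⟩ := key x (hr ▸ hx')
  have hyV : y ∈ V ^ (r + 1) := by
    rw [pow_succ']
    exact (mul_le_mul' inf_le_left le_rfl : linPart V a * V ^ r ≤ V * V ^ r) hy
  have := h.gr (r + 1) _ (sub_mem hx hyV) hy'
  rw [sub_eq_zero] at this
  rwa [this]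

theorem red_mono {W : Submodule k R} {r s : ℕ} (hr : V ^ (r + 1) ≤ W * V ^ r) (hs : r ≤ s) :
    V ^ (s + 1) ≤ W * V ^ s := by
  obtain ⟨t, rfl⟩ := Nat.exists_eq_add_of_le hs
  calc V ^ (r + t + 1) = V ^ (r + 1) * V ^ t := by rw [← pow_add]; congr 1; omega
    _ ≤ (W * V ^ r) * V ^ t := mul_le_mul' hr le_rfl
    _ = W * V ^ (r + t) := by rw [mul_assoc, ← pow_add]

theorem red_of_lin {W : Submodule k R} {b : Ideal R} {r N : ℕ}
    (hr : V ^ (r + 1) ≤ W * V ^ r) (hb : b ≤ Ideal.span (V : Set R))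
    (hWb : (W : Set R) ⊆ (b ⊔ Ideal.span (V : Set R) ^ 2 : Ideal R))
    (hN : Ideal.span (V : Set R) ^ N ≤ b) :
    Ideal.span (V : Set R) ^ (r + 1) = b * Ideal.span (V : Set R) ^ r := by
  set m := Ideal.span (V : Set R) with hm
  apply le_antisymm
  swap
  · rw [pow_succ']; exact Ideal.mul_mono_left hb
  have step : ∀ s, r ≤ s → m ^ (s + 1) ≤ b * m ^ r ⊔ m ^ (s + 2) := by
    intro s hs
    calc m ^ (s + 1) = Ideal.span ((V ^ (s + 1) : Submodule k R) : Set R) := (span_pow_sub V _).symm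
      _ ≤ Ideal.span ((W * V ^ s : Submodule k R) : Set R) := Ideal.span_mono (red_mono hr hs)
      _ = Ideal.span (W : Set R) * m ^ s := by rw [span_mul_sub, span_pow_sub]
      _ ≤ (b ⊔ m ^ 2) * m ^ s := Ideal.mul_mono_left (Ideal.span_le.mpr hWb)
      _ = b * m ^ s ⊔ m ^ (s + 2) := by rw [Ideal.sup_mul, ← pow_add, add_comm 2 s]
      _ ≤ _ := sup_le_sup_right (Ideal.mul_mono_right (Ideal.pow_le_pow_right hs)) _
  have all : ∀ j, m ^ (r + 1) ≤ b * m ^ r ⊔ m ^ (r + 1 + j) := by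
    intro j
    induction j with
    | zero => exact le_sup_right
    | succ j ih =>
      refine ih.trans (sup_le le_sup_left ?_)
      have := step (r + j) (by omega)
      rw [show r + 1 + j = r + j + 1 by omega, show r + 1 + (j + 1) = r + j + 2 by omega]
      exact this
  refine (all N).trans (sup_le le_rfl ?_)
  calc m ^ (r + 1 + N) ≤ m ^ (N + r) := Ideal.pow_le_pow_right (by omega)
    _ = m ^ N * m ^ r := pow_add _ _ _
    _ ≤ _ := Ideal.mul_mono_left hN

end AbstractRed

section AbstractRed2

variable {k : Type*} [Field k] {R : Type*} [CommRing R] [Algebra k R] {V : Submodule k R}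

theorem integral_of_red (hfg : V.FG) (hadj : Algebra.adjoin k (V : Set R) = ⊤)
    {W : Submodule k R} {r : ℕ} (hr : V ^ (r + 1) ≤ W * V ^ r) :
    Algebra.IsIntegral (Algebra.adjoin k (W : Set R)) R := by
  set A := Algebra.adjoin k (W : Set R) with hA
  set U : Submodule k R := ⨆ i ∈ Finset.range (r + 1), V ^ i with hU
  have hUfg : U.FG := Submodule.fg_biSup _ _ fun i _ => hfg.pow i
  obtain ⟨t, ht⟩ := hUfg
  set N : Submodule A R := Submodule.span A (t : Set R) with hN
  have hUN : U ≤ N.restrictScalars k := by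
    rw [← ht, Submodule.span_le]
    exact Submodule.subset_span
  have hVi : ∀ i, i ≤ r → V ^ i ≤ U := fun i hi =>
    le_biSup (fun i => V ^ i) (Finset.mem_range.mpr (Nat.lt_succ_of_le hi))
  have hVr : V ^ (r + 1) ≤ N.restrictScalars k := by
    refine hr.trans (Submodule.mul_le.mpr fun w hw y hy => ?_)
    exact N.smul_mem (⟨w, Algebra.subset_adjoin hw⟩ : A) (hUN (hVi r le_rfl hy))
  have hVN : ∀ v ∈ V, ∀ y ∈ N, v * y ∈ N := by
    intro v hv y hy
    induction hy using Submodule.span_induction with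
    | mem x hx =>
      have hxU : x ∈ U := by rw [← ht]; exact Submodule.subset_span hx
      have : U ≤ (N.restrictScalars k).comap (LinearMap.mulLeft k v) := by
        refine iSup₂_le fun i hi y hy => ?_
        have hvy : v * y ∈ V ^ (i + 1) := by
          rw [pow_succ']; exact Submodule.mul_mem_mul hv hy
        rw [Finset.mem_range] at hi
        rcases Nat.lt_or_ge i r with h | h
        · exact hUN (hVi _ h hvy)
        · have : i = r := by omega
          subst this
          exact hVr hvy
      exact this hxU
    | zero => simp
    | add x y _ _ hx hy => rw [mul_add]; exact add_mem hx hy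
    | smul a x _ hx => rw [mul_smul_comm]; exact N.smul_mem _ hx
  have hall : ∀ x : R, ∀ y ∈ N, x * y ∈ N := by
    intro x
    have hx : x ∈ Algebra.adjoin k (V : Set R) := by rw [hadj]; trivial
    induction hx using Algebra.adjoin_induction with
    | mem x hx => exact hVN x hx
    | algebraMap c =>
      intro y hy
      rw [← Algebra.smul_def]
      exact (N.restrictScalars k).smul_mem c hy
    | add a b _ _ ha hb => intro y hy; rw [add_mul]; exact add_mem (ha y hy) (hb y hy)
    | mul a b _ _ ha hb => intro y hy; rw [mul_assoc]; exact ha _ (hb y hy)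
  have h1 : (1 : R) ∈ N := hUN (hVi 0 (Nat.zero_le _) (by rw [pow_zero]; exact Submodule.one_le.mp le_rfl))
  have htop : N = ⊤ := by
    rw [eq_top_iff]; intro x _; simpa using hall x 1 h1
  have : Module.Finite A R := ⟨⟨t, htop⟩⟩
  infer_instance

theorem not_algInd [Nontrivial R] (h : StdGr V) {W0 : Submodule k R} (hW0 : W0 ≤ V) {r0 : ℕ}
    (hr0 : V ^ (r0 + 1) ≤ W0 * V ^ r0) {e : ℕ} (w : Fin e → R) 
    (he : Module.finrank k W0 < e) : ¬ AlgebraicIndependent k w := by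
  intro hw
  have := h.fin
  have hinj : Function.Injective (aeval w : MvPolynomial (Fin e) k →ₐ[k] R) := hw
  obtain ⟨p, hp, -, hdis⟩ := Ideal.exists_le_prime_disjoint (⊥ : Ideal R)
    ((nonZeroDivisors (MvPolynomial (Fin e) k)).map (aeval w : MvPolynomial (Fin e) k →ₐ[k] R)) (by
      rw [Set.disjoint_left]
      rintro x hx ⟨f, hf, rfl⟩
      have : aeval w f = 0 := hx
      have := (map_eq_zero_iff _ hinj).mp this
      exact nonZeroDivisors.ne_zero hf this)
  let π : R →ₐ[k] R ⧸ p := Ideal.Quotient.mkₐ k p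
  have hw' : AlgebraicIndependent k (π ∘ w) := by
    rw [algebraicIndependent_iff_injective_aeval, injective_iff_map_eq_zero]
    intro f hf
    by_contra hne
    have e1 : aeval (π ∘ w) f = π (aeval w f) := (comp_aeval_apply (f := w) π f).symm
    rw [e1] at hf
    have : aeval w f ∈ p := Ideal.Quotient.eq_zero_iff_mem.mp hf
    exact Set.disjoint_left.mp hdis this ⟨f, mem_nonZeroDivisors_of_ne_zero hne, rfl⟩
  have hWfin : FiniteDimensional k W0 := Submodule.finiteDimensional_of_le hW0
  let b := Module.finBasis k W0
  have hspan : W0 = Submodule.span k (Set.range fun i => (b i : R)) := by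
    have := b.span_eq
    have h2 := congrArg (Submodule.map W0.subtype) this
    rw [Submodule.map_span, Submodule.map_top, Submodule.range_subtype, ← Set.range_comp] at h2
    exact h2.symm
  have hintg := integral_of_red (V := V.map π.toLinearMap) (W := W0.map π.toLinearMap) (r := r0)
    (((Submodule.fg_iff_finiteDimensional _).mpr h.fin).map _) (by
      have := congrArg (Subalgebra.map π) h.adj
      rw [AlgHom.map_adjoin, Algebra.map_top] at this
      rw [Submodule.map_coe]
      refine Eq.trans this ?_
      exact (AlgHom.range_eq_top _).mpr (Ideal.Quotient.mkₐ_surjective k p)) (by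
      rw [← Submodule.map_pow, ← Submodule.map_pow, ← Submodule.map_mul]
      exact Submodule.map_mono hr0)
  rw [hspan, Submodule.map_span, Algebra.adjoin_span] at hintg
  have := Algebra.IsAlgebraic.trdeg_le_cardinalMk k (A := R ⧸ p) (⇑π.toLinearMap '' Set.range fun i => (b i : R))
    (alg := hintg.isAlgebraic)
  have h3 := hw'.lift_cardinalMk_le_trdeg
  rw [← Set.range_comp] at this
  have h4 := Cardinal.mk_range_le_lift (f := (⇑π.toLinearMap ∘ fun i => (b i : R)))
  have h5 := Cardinal.lift_le.{0}.mpr this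
  simp at h3 h4
  have h6 := h3.trans (this.trans h4)
  rw [← Module.finrank_eq_rank] at h6
  have := Nat.cast_le.mp h6
  omega

end AbstractRed2

section AbstractRed3

variable {k : Type*} [Field k] {R : Type*} [CommRing R] [Algebra k R] {V : Submodule k R}

theorem aeval_mem_pow {e : ℕ} (w : Fin e → R) {W : Submodule k R} (hw : ∀ j, w j ∈ W) {i : ℕ}
    {f : MvPolynomial (Fin e) k} (hf : f.IsHomogeneous i) : aeval w f ∈ W ^ i := by
  have hf' : f ∈ (homogeneousSubmodule (Fin e) k 1) ^ i := by
    rw [homogeneousSubmodule_one_pow]; exact hf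
  have h1 : (homogeneousSubmodule (Fin e) k 1).map (aeval w : _ →ₐ[k] R).toLinearMap ≤ W := by
    rw [homogeneousSubmodule_one_eq_span_X, Submodule.map_span, Submodule.span_le]
    rintro _ ⟨_, ⟨j, rfl⟩, rfl⟩
    simpa using hw j
  have h2 := Submodule.mem_map_of_mem (f := (aeval w : _ →ₐ[k] R).toLinearMap) hf'
  rw [Submodule.map_pow] at h2
  exact (pow_le_pow_left' h1 i : _) h2

theorem exists_homog_rel [Nontrivial R] (h : StdGr V) {e : ℕ} (w : Fin e → R) (hw : ∀ j, w j ∈ V)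
    (hn : ¬ AlgebraicIndependent k w) :
    ∃ (i : ℕ) (G : MvPolynomial (Fin e) k), G ≠ 0 ∧ G.IsHomogeneous i ∧ aeval w G = 0 := by
  rw [algebraicIndependent_iff_injective_aeval, injective_iff_map_eq_zero] at hn
  push Not at hn
  obtain ⟨F, hF0, hF⟩ := hn
  have hex : ∃ i, homogeneousComponent i F ≠ 0 := by
    by_contra hc
    push Not at hc
    apply hF
    rw [← sum_homogeneousComponent F]
    exact Finset.sum_eq_zero fun i _ => hc i
  classical
  obtain ⟨i, hi, hmin⟩ : ∃ i, homogeneousComponent i F ≠ 0 ∧ ∀ j < i, homogeneousComponent j F = 0 :=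
    ⟨Nat.find hex, Nat.find_spec hex, fun j hj => not_not.mp (Nat.find_min hex hj)⟩
  refine ⟨i, _, hi, homogeneousComponent_isHomogeneous i F, ?_⟩
  apply h.gr i _ (aeval_mem_pow w hw (homogeneousComponent_isHomogeneous i F))
  have hir : i ∈ Finset.range (F.totalDegree + 1) := by
    rw [Finset.mem_range]
    by_contra hc
    exact hi (homogeneousComponent_eq_zero _ _ (by omega))
  have hs := sum_homogeneousComponent F
  rw [← Finset.add_sum_erase _ _ hir] at hs
  have hs2 := congrArg (aeval w : _ →ₐ[k] R) hs
  rw [hF0, map_add, map_sum] at hs2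
  rw [eq_neg_of_add_eq_zero_left hs2]
  refine neg_mem (sum_mem fun j hj => ?_)
  have hji := Finset.ne_of_mem_erase hj
  rcases lt_or_gt_of_ne hji with hlt | hgt
  · rw [hmin j hlt, map_zero]; exact zero_mem _
  · have h1 := aeval_mem_pow w hw (homogeneousComponent_isHomogeneous j F)
    have h2 : aeval w (homogeneousComponent j F) ∈ Ideal.span (V : Set R) ^ j := by
      rw [← span_pow_sub]; exact Ideal.subset_span h1
    exact Ideal.pow_le_pow_right hgt h2

theorem exists_smaller [Infinite k] (h : StdGr V) {W : Submodule k R} (hW : W ≤ V) {r : ℕ}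
    (hr : V ^ (r + 1) ≤ W * V ^ r) {W0 : Submodule k R} (hW0 : W0 ≤ V) {r0 : ℕ}
    (hr0 : V ^ (r0 + 1) ≤ W0 * V ^ r0) (hlt : Module.finrank k W0 < Module.finrank k W) :
    ∃ W' < W, ∃ r', V ^ (r' + 1) ≤ W' * V ^ r' := by
  have : Nontrivial R := by
    by_contra hc
    rw [not_nontrivial_iff_subsingleton] at hc
    have : Module.finrank k W = 0 := Module.finrank_zero_of_subsingleton
    omega
  have hVfin := h.fin
  have hWfin : FiniteDimensional k W := Submodule.finiteDimensional_of_le hW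
  let b := Module.finBasis k W
  set w : Fin (Module.finrank k W) → R := fun i => (b i : R) with hwdef
  have hspan : W = Submodule.span k (Set.range w) := by
    have := b.span_eq
    have h2 := congrArg (Submodule.map W.subtype) this
    rw [Submodule.map_span, Submodule.map_top, Submodule.range_subtype, ← Set.range_comp] at h2
    exact h2.symm
  have hwW : ∀ j, w j ∈ W := fun j => (b j).2
  obtain ⟨i, G, hG0, hGh, hG⟩ := exists_homog_rel h w (fun j => hW (hwW j))
    (not_algInd h hW0 hr0 w hlt)
  obtain ⟨c, hc⟩ : ∃ c, eval c G ≠ 0 := by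
    by_contra hcon
    push Not at hcon
    exact hG0 (MvPolynomial.funext fun x => by simpa using hcon x)
  obtain ⟨s, rfl⟩ : ∃ s, i = s + 1 := by
    rcases i with _ | s
    · exfalso
      rw [← totalDegree_zero_iff_isHomogeneous, totalDegree_eq_zero_iff_eq_C] at hGh
      rw [hGh, aeval_C, map_eq_zero_iff _ (algebraMap k R).injective] at hG
      rw [hG] at hGh
      simp at hGh
      exact hG0 hGh
    · exact ⟨s, rfl⟩
  obtain ⟨j0, hj0⟩ : ∃ j0, c j0 ≠ 0 := by
    by_contra hcon
    push Not at hcon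
    have : c = 0 := funext hcon
    apply hc
    rw [this]
    have h00 : eval (0 : Fin (Module.finrank k W) → k) G = coeff 0 G := by
      rw [← constantCoeff_eq, ← eval_zero]
    rw [h00]
    exact hGh.coeff_eq_zero (by simp)
  set z : R := (c j0)⁻¹ • w j0 with hz
  have hzW : z ∈ W := W.smul_mem _ (hwW j0)
  set w' : Fin (Module.finrank k W) → R := fun j => w j - c j • z with hw'
  set W' := Submodule.span k (Set.range w') with hW'
  have hw'0 : w' j0 = 0 := by
    simp [hw', hz, smul_smul, hj0]
  have hw'W : ∀ j, w' j ∈ W := fun j => sub_mem (hwW j) (W.smul_mem _ hzW)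
  have hW'W : W' ≤ W := by
    rw [hW', Submodule.span_le]; rintro _ ⟨j, rfl⟩; exact hw'W j
  have hw'W' : ∀ j, w' j ∈ W' := fun j => Submodule.subset_span ⟨j, rfl⟩
  have hWsup : W ≤ W' ⊔ Submodule.span k {z} := by
    rw [hspan, Submodule.span_le]
    rintro _ ⟨j, rfl⟩
    have : w j = w' j + c j • z := by simp [hw']
    rw [this]
    exact add_mem (Submodule.mem_sup_left (hw'W' j))
      (Submodule.mem_sup_right (Submodule.smul_mem _ _ (Submodule.mem_span_singleton_self z)))
  have hW'lt : Module.finrank k W' < Module.finrank k W := by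
    classical
    have h1 : W' ≤ Submodule.span k (((Finset.univ.erase j0).image w' : Finset R) : Set R) := by
      rw [hW', Submodule.span_le]
      rintro _ ⟨j, rfl⟩
      by_cases hj : j = j0
      · rw [hj, hw'0]; exact zero_mem _
      · apply Submodule.subset_span
        simp only [Finset.coe_image]
        exact ⟨j, by simp [hj], rfl⟩
    have h2 := Submodule.finrank_mono h1
    have h3 := finrank_span_finset_le_card (R := k) ((Finset.univ.erase j0).image w')
    have h4 := Finset.card_image_le (s := Finset.univ.erase j0) (f := w')
    rw [Finset.card_erase_of_mem (Finset.mem_univ _), Finset.card_univ, Fintype.card_fin] at h4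
    have h5 : 0 < Module.finrank k W := by omega
    have h6 := (h2.trans h3).trans h4
    omega
  -- congruence
  let T : ℕ → Submodule k R := fun i => Nat.casesOn i ⊥ fun s => W' * W ^ s
  have hT : ∀ i, T i * W ≤ T (i + 1) := by
    intro i
    rcases i with _ | i
    · simp [T]
    · simp only [T]
      rw [mul_assoc, ← pow_succ]
  have hlin : ∀ f ∈ homogeneousSubmodule (Fin (Module.finrank k W)) k 1,
      aeval w f ∈ W ∧ aeval w f - eval c f • z ∈ W' := by
    intro f hf
    rw [homogeneousSubmodule_one_eq_span_X] at hf
    induction hf using Submodule.span_induction with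
    | mem x hx =>
      obtain ⟨j, rfl⟩ := hx
      simpa using ⟨hwW j, hw'W' j⟩
    | zero => simp
    | add x y _ _ hx hy =>
      rw [map_add, map_add]
      refine ⟨add_mem hx.1 hy.1, ?_⟩
      convert add_mem hx.2 hy.2 using 1
      rw [add_smul]; ring
    | smul a x _ hx =>
      rw [map_smul, smul_eval, mul_smul, ← smul_sub]
      exact ⟨W.smul_mem _ hx.1, W'.smul_mem _ hx.2⟩
  have hcong : ∀ (i : ℕ) (f : MvPolynomial (Fin (Module.finrank k W)) k)
      (_ : f ∈ homogeneousSubmodule (Fin (Module.finrank k W)) k 1 ^ i),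
      aeval w f - eval c f • z ^ i ∈ T i := by
    intro i f hf
    induction hf using Submodule.pow_induction_on_right' with
    | algebraMap a => simp [T, algebraMap_eq, Algebra.smul_def]
    | add x y i _ _ hx hy =>
      rw [map_add, map_add]
      convert add_mem hx hy using 1
      rw [add_smul]; ring
    | mul_mem i x hx ih l hl =>
      obtain ⟨h1, h2⟩ := hlin l hl
      have e : aeval w (x * l) - eval c (x * l) • z ^ (i + 1)
          = (aeval w x - eval c x • z ^ i) * aeval w l
            + (aeval w l - eval c l • z) * (eval c x • z ^ i) := by
        rw [map_mul, map_mul]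
        simp only [Algebra.smul_def, map_mul]
        ring
      rw [e]
      refine add_mem (hT i (Submodule.mul_mem_mul ih h1)) ?_
      exact Submodule.mul_mem_mul h2 (Submodule.smul_mem _ _ (Submodule.pow_mem_pow _ hzW i))
  have hzT : z ^ (s + 1) ∈ W' * W ^ s := by
    have h1 := hcong (s + 1) G (by rw [homogeneousSubmodule_one_pow]; exact hGh)
    rw [hG, zero_sub] at h1
    have h2 := (W' * W ^ s).smul_mem (eval c G)⁻¹ (neg_mem h1 : - -(eval c G • z ^ (s+1)) ∈ W' * W ^ s)
    rwa [neg_neg, smul_smul, inv_mul_cancel₀ hc, one_smul] at h2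
  have hpow : ∀ t, W ^ (t + 1) ≤ W' * W ^ t ⊔ Submodule.span k {z ^ (t + 1)} := by
    intro t
    induction t with
    | zero => simpa using hWsup
    | succ t ih =>
      calc W ^ (t + 1 + 1) = W ^ (t + 1) * W := pow_succ _ _
        _ ≤ (W' * W ^ t ⊔ Submodule.span k {z ^ (t + 1)}) * W := mul_le_mul' ih le_rfl
        _ = W' * W ^ (t + 1) ⊔ Submodule.span k {z ^ (t + 1)} * W := by
          rw [Submodule.sup_mul, mul_assoc, ← pow_succ]
        _ ≤ W' * W ^ (t + 1) ⊔ Submodule.span k {z ^ (t + 1)} * (W' ⊔ Submodule.span k {z}) :=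
          sup_le_sup_left (mul_le_mul' le_rfl hWsup) _
        _ ≤ _ := by
          rw [Submodule.mul_sup, Submodule.span_mul_span k {z ^ (t + 1)} {z}, Set.singleton_mul_singleton, ← pow_succ]
          refine sup_le le_sup_left (sup_le (le_sup_of_le_left ?_) le_sup_right)
          rw [mul_comm]
          refine mul_le_mul' le_rfl ?_
          rw [Submodule.span_singleton_le_iff_mem]
          exact Submodule.pow_mem_pow _ hzW _
  have hWs : W ^ (s + 1) ≤ W' * W ^ s := by
    refine (hpow s).trans (sup_le le_rfl ?_)
    rw [Submodule.span_singleton_le_iff_mem]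
    exact hzT
  have hVt : ∀ t, V ^ (r + t) ≤ W ^ t * V ^ r := by
    intro t
    induction t with
    | zero => simp
    | succ t ih =>
      calc V ^ (r + (t + 1)) = V ^ (r + t + 1) := rfl
        _ ≤ W * V ^ (r + t) := red_mono hr (by omega)
        _ ≤ W * (W ^ t * V ^ r) := mul_le_mul' le_rfl ih
        _ = W ^ (t + 1) * V ^ r := by rw [← mul_assoc, ← pow_succ']
  refine ⟨W', lt_of_le_of_ne hW'W (fun he => by rw [he] at hW'lt; exact lt_irrefl _ hW'lt), r + s, ?_⟩
  calc V ^ (r + s + 1) ≤ W ^ (s + 1) * V ^ r := hVt (s + 1)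
    _ ≤ W' * W ^ s * V ^ r := mul_le_mul' hWs le_rfl
    _ ≤ W' * V ^ s * V ^ r := mul_le_mul' (mul_le_mul' le_rfl (pow_le_pow_left' hW s)) le_rfl
    _ = W' * V ^ (r + s) := by rw [mul_assoc, ← pow_add, add_comm]

theorem StdGr.span_lead (h : StdGr V) {W : Submodule k R} {x : R}
    (hx : x ∈ Ideal.span (W : Set R)) :
    ∃ y ∈ W, x - y ∈ Ideal.span (V : Set R) * Ideal.span (W : Set R) := by
  induction hx using Submodule.span_induction with
  | mem x hx => exact ⟨x, hx, by simp⟩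
  | zero => exact ⟨0, zero_mem _, by simp⟩
  | add x y _ _ hx hy =>
    obtain ⟨a, ha, ha'⟩ := hx
    obtain ⟨b, hb, hb'⟩ := hy
    exact ⟨a + b, add_mem ha hb, by convert add_mem ha' hb' using 1; ring⟩
  | smul a x hx ih =>
    obtain ⟨b, hb, hb'⟩ := ih
    obtain ⟨c, hc⟩ := h.gen a
    refine ⟨c • b, Submodule.smul_mem _ _ hb, ?_⟩
    have e : a • x - c • b = (a - algebraMap k R c) * x + algebraMap k R c * (x - b) := by
      rw [Algebra.smul_def c b, smul_eq_mul]; ring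
    rw [e]
    exact add_mem (Ideal.mul_mem_mul hc hx) (Ideal.mul_mem_left _ _ hb')

theorem StdGr.lin_mem (h : StdGr V) {W : Submodule k R} (hW : W ≤ V) {v : R} (hv : v ∈ V)
    (hv' : v ∈ Ideal.span (W : Set R) ⊔ Ideal.span (V : Set R) ^ 2) : v ∈ W := by
  obtain ⟨y, hy, c, hc, rfl⟩ := Submodule.mem_sup.mp hv'
  obtain ⟨w, hw, hw'⟩ := h.span_lead hy
  have h2 : Ideal.span (V : Set R) * Ideal.span (W : Set R) ≤ Ideal.span (V : Set R) ^ 2 := by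
    rw [pow_two]; exact Ideal.mul_mono_right (Ideal.span_mono hW)
  have h3 := h.gr 1 (y + c - w) (by rw [pow_one]; exact sub_mem hv (hW hw)) (by
    have : y + c - w = (y - w) + c := by ring
    rw [this]; exact add_mem (h2 hw') hc)
  rw [sub_eq_zero] at h3
  rwa [h3]

/-- `e`-dimensional spaces of linear forms with reduction number at most `r` -/
def Qr (V : Submodule k R) (e r : ℕ) : Prop :=
  ∃ W ≤ V, Module.finrank k W ≤ e ∧ V ^ (r + 1) ≤ W * V ^ r

theorem ringRedNum_eq [Infinite k] (h : StdGr V) :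
    ringRedNum (Ideal.span (V : Set R)) = sInf {r | Qr V (sInf {e | ∃ r, Qr V e r}) r} := by
  set d := sInf {e | ∃ r, Qr V e r} with hd
  set m := Ideal.span (V : Set R) with hm
  have hfin := h.fin
  have hex : ∃ r, Qr V d r := Nat.sInf_mem (s := {e | ∃ r, Qr V e r})
    ⟨Module.finrank k V, 0, V, le_rfl, le_rfl, by simp⟩
  have hdmin : ∀ W ≤ V, ∀ r, V ^ (r + 1) ≤ W * V ^ r → d ≤ Module.finrank k W :=
    fun W hW r hr => Nat.sInf_le ⟨r, W, hW, le_rfl, hr⟩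
  obtain ⟨W, hW, hWd, hWr⟩ := Nat.sInf_mem (s := {r | Qr V d r}) hex
  set r0 := sInf {r | Qr V d r} with hr0
  have hred_pow : ∀ a, IsReduction m a → ∃ N, m ^ N ≤ a := by
    rintro a ⟨-, N, hN⟩
    exact ⟨N + 1, (hN N le_rfl).le.trans Ideal.mul_le_left⟩
  have hWfin : FiniteDimensional k W := Submodule.finiteDimensional_of_le hW
  set a := Ideal.span (W : Set R) with ha
  have ham : a ≤ m := Ideal.span_mono hW
  have haN : m ^ (r0 + 1) ≤ a := by
    rw [hm, ← span_pow_sub]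
    refine (Ideal.span_mono hWr).trans ?_
    rw [span_mul_sub]
    exact Ideal.mul_le_left
  have hared : ∀ r ≥ r0, m ^ (r + 1) = a * m ^ r := fun r hr =>
    red_of_lin (red_mono hWr hr) ham
      (fun x hx => Ideal.mem_sup_left (Ideal.subset_span hx)) haN
  have hamin : IsMinimalReduction m a := by
    refine ⟨⟨ham, r0, hared⟩, fun b hb hba => le_antisymm hba ?_⟩
    obtain ⟨N, hN⟩ := hred_pow b hb
    have hbW : linPart V b ≤ W := fun v hv =>
      h.lin_mem hW hv.1 (sup_le_sup_right hba _ hv.2)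
    obtain ⟨hbm, N', hN'⟩ := hb
    have hbr := h.linPart_red hbm (hN' N' le_rfl)
    have heq : linPart V b = W := Submodule.eq_of_le_of_finrank_le hbW
      (hWd.trans (hdmin _ inf_le_left _ hbr))
    have hm2 : m * a ≤ m ^ 2 := by rw [pow_two]; exact Ideal.mul_mono_right ham
    have step : a ≤ b ⊔ m * a := by
      rw [ha, Ideal.span_le]
      intro w hw
      have hw' : w ∈ linPart V b := by rw [heq]; exact hw
      obtain ⟨u, hu, c, hc, huc⟩ := Submodule.mem_sup.mp hw'.2
      have hca : c ∈ a := by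
        have : c = w - u := by rw [← huc]; ring
        rw [this]
        exact sub_mem (Ideal.subset_span hw) (hba hu)
      obtain ⟨y, hy, hy'⟩ := h.span_lead hca
      have hy0 : y = 0 := h.gr 1 y (by rw [pow_one]; exact hW hy) (by
        have : y = c - (c - y) := by ring
        rw [this]
        exact sub_mem hc (hm2 hy'))
      rw [hy0, sub_zero] at hy'
      rw [← huc]
      exact add_mem (Ideal.mem_sup_left hu) (Ideal.mem_sup_right hy')
    have all : ∀ j, a ≤ b ⊔ m ^ j * a := by
      intro j
      induction j with
      | zero => simp
      | succ j ih =>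
        refine ih.trans (sup_le le_sup_left ?_)
        calc m ^ j * a ≤ m ^ j * (b ⊔ m * a) := Ideal.mul_mono_right step
          _ = m ^ j * b ⊔ m ^ (j + 1) * a := by rw [Ideal.mul_sup, ← mul_assoc, ← pow_succ]
          _ ≤ _ := sup_le_sup_right Ideal.mul_le_right _
    exact (all N).trans (sup_le le_rfl (Ideal.mul_le_left.trans hN))
  apply le_antisymm
  · calc ringRedNum m ≤ redNum m a := Nat.sInf_le ⟨a, hamin, rfl⟩
      _ ≤ r0 := Nat.sInf_le (hared r0 le_rfl)
  · obtain ⟨a', ha', hr'⟩ := Nat.sInf_mem (s := {r | ∃ a, IsMinimalReduction m a ∧ redNum m a = r})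
      ⟨_, a, hamin, rfl⟩
    have hρ : ringRedNum m = redNum m a' := hr'.symm
    rw [hρ]
    have hmem : m ^ (redNum m a' + 1) = a' * m ^ (redNum m a') := by
      obtain ⟨-, N, hN⟩ := ha'.1
      exact Nat.sInf_mem (s := {r | m ^ (r + 1) = a' * m ^ r}) ⟨N, hN N le_rfl⟩
    have hP := h.linPart_red ha'.1.1 hmem
    refine Nat.sInf_le ⟨linPart V a', inf_le_left, ?_, hP⟩
    by_contra hcon
    push Not at hcon
    obtain ⟨W', hW', r', hP'⟩ := exists_smaller h inf_le_left hP hW hWr (hWd.trans_lt hcon)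
    have hW'V : W' ≤ V := hW'.le.trans inf_le_left
    obtain ⟨N, hN⟩ := hred_pow a' ha'.1
    set b := a' ⊓ (Ideal.span (W' : Set R) ⊔ m ^ 2) with hb
    have hbred : ∀ r ≥ r', m ^ (r + 1) = b * m ^ r := by
      intro r hr
      refine red_of_lin (W := W') (N := N + 2) (red_mono hP' hr) (inf_le_left.trans ha'.1.1) ?_ ?_
      · intro w hw
        obtain ⟨u, hu, c, hc, huc⟩ := Submodule.mem_sup.mp (hW'.le hw).2
        rw [← huc]
        refine add_mem (Ideal.mem_sup_left ⟨hu, ?_⟩) (Ideal.mem_sup_right hc)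
        have : u = w - c := by rw [← huc]; ring
        rw [this]
        exact sub_mem (Ideal.mem_sup_left (Ideal.subset_span hw)) (Ideal.mem_sup_right hc)
      · exact le_inf ((Ideal.pow_le_pow_right (by omega)).trans hN)
          (le_sup_of_le_right (Ideal.pow_le_pow_right (by omega)))
    have hba : b = a' := ha'.2 b ⟨inf_le_left.trans ha'.1.1, r', hbred⟩ inf_le_left
    refine hW'.not_ge fun v hv => h.lin_mem hW'V hv.1 ?_
    refine (sup_le ?_ le_sup_right : a' ⊔ m ^ 2 ≤ _) hv.2
    rw [← hba]; exact inf_le_right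

end AbstractRed3

section PartB
variable {k : Type*} [Field k] {n : ℕ}

/-- Degree one piece of the quotient. -/
def qV (K : Ideal (MvPolynomial (Fin n) k)) : Submodule k (MvPolynomial (Fin n) k ⧸ K) :=
  (homogeneousSubmodule (Fin n) k 1).map (Ideal.Quotient.mkₐ k K).toLinearMap

theorem qV_pow (K : Ideal (MvPolynomial (Fin n) k)) (r : ℕ) :
    qV K ^ r = (homogeneousSubmodule (Fin n) k r).map (Ideal.Quotient.mkₐ k K).toLinearMap := by
  rw [qV, ← homogeneousSubmodule_one_pow k r, Submodule.map_pow]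

theorem qV_span (K : Ideal (MvPolynomial (Fin n) k)) :
    Ideal.span (qV K : Set (MvPolynomial (Fin n) k ⧸ K)) = maxIdealQ K := by
  rw [qV, homogeneousSubmodule_one_eq_span_X, maxIdealQ, maxIdeal, Ideal.map_span,
    Submodule.map_span]
  apply le_antisymm
  · rw [Ideal.span_le]
    intro x hx
    have : Submodule.span k ((Ideal.Quotient.mkₐ k K).toLinearMap '' (Set.range X)) ≤
      (Ideal.span ((Ideal.Quotient.mk K) '' (Set.range X))).restrictScalars k := by
      rw [Submodule.span_le]
      intro y hy
      exact Ideal.subset_span hy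
    exact this hx
  · exact Ideal.span_mono (fun x hx => Submodule.subset_span hx)

theorem qV_stdGr {K : Ideal (MvPolynomial (Fin n) k)} (hK : IsHomog K) : StdGr (qV K) where
  fin := by
    rw [qV, homogeneousSubmodule_one_eq_span_X]
    have : FiniteDimensional k (Submodule.span k
      (Set.range (X : Fin n → MvPolynomial (Fin n) k))) :=
      FiniteDimensional.span_of_finite k (Set.finite_range _)
    infer_instance
  gen := by
    intro x
    obtain ⟨f, rfl⟩ := Ideal.Quotient.mk_surjective x
    refine ⟨coeff 0 f, ?_⟩
    rw [qV_span]
    have h1 : algebraMap k (MvPolynomial (Fin n) k ⧸ K) (coeff 0 f) =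
      Ideal.Quotient.mk K (C (coeff 0 f)) := rfl
    rw [h1, ← map_sub]
    apply Ideal.mem_map_of_mem
    have := (mem_pow_idealOfVars_iff' 1 (f - C (coeff 0 f))).mpr (by
      intro x hx
      have hx : x = 0 := by
        rw [Nat.lt_one_iff] at hx
        exact (Finsupp.degree_eq_zero_iff x).mp hx
      subst hx
      simp)
    rwa [pow_one] at this
  adj := by
    have : Algebra.adjoin k (qV K : Set (MvPolynomial (Fin n) k ⧸ K)) =
      (Algebra.adjoin k (homogeneousSubmodule (Fin n) k 1 :
        Set (MvPolynomial (Fin n) k))).map (Ideal.Quotient.mkₐ k K) := by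
      rw [AlgHom.map_adjoin]; rfl
    rw [this]
    have h2 : Algebra.adjoin k (homogeneousSubmodule (Fin n) k 1 :
        Set (MvPolynomial (Fin n) k)) = ⊤ := by
      rw [eq_top_iff, ← adjoin_range_X]
      apply Algebra.adjoin_mono
      rintro _ ⟨i, rfl⟩
      exact isHomogeneous_X k i
    rw [h2, Algebra.map_top, AlgHom.range_eq_top]
    exact Ideal.Quotient.mkₐ_surjective k K
  gr := by
    intro r x hx hx'
    rw [qV_pow] at hx
    obtain ⟨f, hf, rfl⟩ := hx
    rw [qV_span, maxIdealQ, ← Ideal.map_pow] at hx'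
    obtain ⟨g, hg, hgf⟩ := (Ideal.mem_map_iff_of_surjective _ Ideal.Quotient.mk_surjective).mp hx'
    have h1 : f - g ∈ K := by
      rw [← Ideal.Quotient.eq]; exact hgf.symm
    have h2 := hK _ h1 r
    have h3 : homogeneousComponent r g = 0 := by
      apply homogeneousComponent_eq_zero'
      intro d hd hdr
      have := (mem_pow_idealOfVars_iff (r + 1) g).mp hg d hd
      omega
    rw [map_sub, h3, sub_zero, homogeneousComponent_eq_self hf] at h2
    exact Ideal.Quotient.eq_zero_iff_mem.mpr h2

/-- Lifted version of `Qr`. -/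
def QK (K : Ideal (MvPolynomial (Fin n) k)) (e r : ℕ) : Prop :=
  ∃ L ≤ homogeneousSubmodule (Fin n) k 1, Module.finrank k L ≤ e ∧
    homogeneousSubmodule (Fin n) k (r + 1) ≤
      L * homogeneousSubmodule (Fin n) k r ⊔ K.restrictScalars k

instance fd_H1 : FiniteDimensional k (homogeneousSubmodule (Fin n) k 1) := by
  rw [homogeneousSubmodule_one_eq_span_X]
  exact FiniteDimensional.span_of_finite k (Set.finite_range _)

theorem Qr_iff_QK (K : Ideal (MvPolynomial (Fin n) k)) (e r : ℕ) :
    Qr (qV K) e r ↔ QK K e r := by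
  have hfd : FiniteDimensional k (qV K) := by
    unfold qV; infer_instance
  constructor
  · rintro ⟨W, hW, hWe, hWr⟩
    have hWfin : FiniteDimensional k W := Submodule.finiteDimensional_of_le hW
    let b := Module.finBasis k W
    have hb : ∀ i, ∃ p ∈ homogeneousSubmodule (Fin n) k 1, Ideal.Quotient.mk K p = (b i : _) := by
      intro i
      obtain ⟨p, hp, hp'⟩ := hW (b i).2
      exact ⟨p, hp, hp'⟩
    choose p hp hpb using hb
    have hmap : (Submodule.span k (Set.range p)).map (Ideal.Quotient.mkₐ k K).toLinearMap = W := by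
      have h1 : (⊤ : Submodule k W).map W.subtype = W := by simp
      refine Eq.trans ?_ h1
      rw [← b.span_eq, Submodule.map_span, Submodule.map_span, ← Set.range_comp,
        ← Set.range_comp]
      congr 2
      funext i
      exact hpb i
    refine ⟨Submodule.span k (Set.range p), ?_, ?_, ?_⟩
    · rw [Submodule.span_le]
      rintro _ ⟨i, rfl⟩
      exact hp i
    · refine (finrank_range_le_card p).trans ?_
      simpa using hWe
    · intro f hf
      have h1 : Ideal.Quotient.mk K f ∈ qV K ^ (r + 1) := by
        rw [qV_pow]; exact ⟨f, hf, rfl⟩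
      have h2 := hWr h1
      rw [qV_pow, ← hmap, ← Submodule.map_mul] at h2
      obtain ⟨g, hg, hgf⟩ := h2
      have h3 : f - g ∈ K := by
        rw [← Ideal.Quotient.eq]; exact hgf.symm
      rw [← add_sub_cancel g f]
      exact Submodule.add_mem_sup hg h3
  · rintro ⟨L, hL, hLe, hLr⟩
    have hLfin : FiniteDimensional k L := Submodule.finiteDimensional_of_le hL
    refine ⟨L.map (Ideal.Quotient.mkₐ k K).toLinearMap, Submodule.map_mono hL,
      (Submodule.finrank_map_le _ _).trans hLe, ?_⟩
    rw [qV_pow, qV_pow, ← Submodule.map_mul]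
    rintro _ ⟨f, hf, rfl⟩
    obtain ⟨u, hu, v, hv, huv⟩ := Submodule.mem_sup.mp (hLr hf)
    refine ⟨u, hu, ?_⟩
    have : f - u ∈ K := by
      rw [← huv]; simpa using hv
    exact (Ideal.Quotient.eq.mpr this).symm

theorem ringRedNum_eq_of_QK [Infinite k] {I J : Ideal (MvPolynomial (Fin n) k)}
    (hI : IsHomog I) (hJ : IsHomog J) (h : ∀ e r, QK I e r ↔ QK J e r) :
    ringRedNum (maxIdealQ I) = ringRedNum (maxIdealQ J) := by
  rw [← qV_span, ← qV_span, ringRedNum_eq (qV_stdGr hI), ringRedNum_eq (qV_stdGr hJ)]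
  simp only [Qr_iff_QK, h]

end PartB

section PartC
variable {k : Type*} [Field k] {n : ℕ}

theorem act_X (g : Matrix (Fin n) (Fin n) k) (j : Fin n) :
    act g (X j) = ∑ i, C (g i j) * X i := by
  simp [act]

theorem act_mul (g h : Matrix (Fin n) (Fin n) k) :
    act (g * h) = (act g).comp (act h) := by
  apply algHom_ext
  intro j
  rw [AlgHom.comp_apply, act_X, act_X, map_sum]
  simp only [map_mul, algHom_C, act_X, Matrix.mul_apply, map_sum, Finset.sum_mul,
    Finset.mul_sum, algebraMap_eq]
  rw [Finset.sum_comm]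
  refine Finset.sum_congr rfl fun i _ => Finset.sum_congr rfl fun l _ => ?_
  ring

theorem act_one : act (1 : Matrix (Fin n) (Fin n) k) = AlgHom.id k _ := by
  apply algHom_ext
  intro j
  rw [act_X, AlgHom.id_apply, Finset.sum_eq_single j]
  · simp
  · intro b _ hb
    simp [Matrix.one_apply_ne hb]
  · simp

theorem act_inv_act {g : Matrix (Fin n) (Fin n) k} (hg : IsUnit g.det)
    (f : MvPolynomial (Fin n) k) : act g⁻¹ (act g f) = f := by
  rw [← AlgHom.comp_apply, ← act_mul, Matrix.nonsing_inv_mul _ hg, act_one]; rfl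

theorem act_act_inv {g : Matrix (Fin n) (Fin n) k} (hg : IsUnit g.det)
    (f : MvPolynomial (Fin n) k) : act g (act g⁻¹ f) = f := by
  rw [← AlgHom.comp_apply, ← act_mul, Matrix.mul_nonsing_inv _ hg, act_one]; rfl

theorem act_homog (g : Matrix (Fin n) (Fin n) k) {f : MvPolynomial (Fin n) k} {d : ℕ}
    (hf : f.IsHomogeneous d) : (act g f).IsHomogeneous d := by
  have := hf.aeval (fun j => ∑ i, C (g i j) * (X i : MvPolynomial (Fin n) k)) (n := 1)
    (fun j => IsHomogeneous.sum _ _ _ fun i _ => by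
      simpa using (isHomogeneous_C _ (g i j)).mul (isHomogeneous_X k i))
  simpa [act] using this

theorem act_homogComp (g : Matrix (Fin n) (Fin n) k) (f : MvPolynomial (Fin n) k) (d : ℕ) :
    homogeneousComponent d (act g f) = act g (homogeneousComponent d f) := by
  conv_lhs => rw [← sum_homogeneousComponent f]
  rw [map_sum, map_sum]
  have : ∀ i, homogeneousComponent d (act g (homogeneousComponent i f)) =
      if d = i then act g (homogeneousComponent d f) else 0 := by
    intro i
    rw [homogeneousComponent_of_mem (act_homog g (homogeneousComponent_isHomogeneous i f))]
    split_ifs with h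
    · rw [h]
    · rfl
  simp only [this]
  rw [Finset.sum_ite_eq]
  split_ifs with h
  · rfl
  · rw [homogeneousComponent_eq_zero, map_zero]
    simpa using h

theorem mem_actI {g : Matrix (Fin n) (Fin n) k} (hg : IsUnit g.det)
    {I : Ideal (MvPolynomial (Fin n) k)} {f : MvPolynomial (Fin n) k} :
    f ∈ actI g I ↔ act g⁻¹ f ∈ I := by
  have hs : Function.Surjective (act g) := fun f => ⟨_, act_act_inv hg f⟩
  constructor
  · intro hf
    obtain ⟨x, hx, rfl⟩ := (Ideal.mem_map_iff_of_surjective (act g) hs).mp hf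
    rwa [act_inv_act hg]
  · intro hf
    rw [← act_act_inv hg f]
    exact Ideal.mem_map_of_mem _ hf

theorem actI_homog {g : Matrix (Fin n) (Fin n) k} (hg : IsUnit g.det)
    {I : Ideal (MvPolynomial (Fin n) k)} (hI : IsHomog I) : IsHomog (actI g I) := by
  intro f hf d
  rw [mem_actI hg] at hf ⊢
  rw [← act_homogComp]
  exact hI _ hf d

theorem actI_mul (g h : Matrix (Fin n) (Fin n) k) (I : Ideal (MvPolynomial (Fin n) k)) :
    actI (g * h) I = actI g (actI h I) := by
  apply le_antisymm
  · rw [actI, Ideal.map_le_iff_le_comap]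
    intro f hf
    rw [Ideal.mem_comap, act_mul]
    exact Ideal.mem_map_of_mem _ (Ideal.mem_map_of_mem _ hf)
  · rw [actI, actI, Ideal.map_le_iff_le_comap, Ideal.map_le_iff_le_comap]
    intro f hf
    rw [Ideal.mem_comap, Ideal.mem_comap, ← AlgHom.comp_apply, ← act_mul]
    exact Ideal.mem_map_of_mem _ hf

/-- Transport of the inclusion along a change of coordinates. -/
theorem incl_act {g : Matrix (Fin n) (Fin n) k} (hg : IsUnit g.det)
    {K : Ideal (MvPolynomial (Fin n) k)} {L : Submodule k (MvPolynomial (Fin n) k)} {r : ℕ}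
    (h : homogeneousSubmodule (Fin n) k (r + 1) ≤
      L * homogeneousSubmodule (Fin n) k r ⊔ K.restrictScalars k) :
    homogeneousSubmodule (Fin n) k (r + 1) ≤
      L.map (act g).toLinearMap * homogeneousSubmodule (Fin n) k r ⊔
        (actI g K).restrictScalars k := by
  intro f hf
  obtain ⟨u, hu, v, hv, huv⟩ := Submodule.mem_sup.mp (h (act_homog g⁻¹ hf))
  rw [← act_act_inv hg f, ← huv, map_add]
  refine Submodule.add_mem_sup ?_ (Ideal.mem_map_of_mem _ hv)
  have h1 : act g u ∈ (L * homogeneousSubmodule (Fin n) k r).map (act g).toLinearMap :=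
    ⟨u, hu, rfl⟩
  rw [Submodule.map_mul] at h1
  refine (mul_le_mul' le_rfl ?_ : _ ≤ L.map (act g).toLinearMap * homogeneousSubmodule (Fin n) k r) h1
  rintro _ ⟨w, hw, rfl⟩
  exact act_homog g hw

theorem QK_of_actI {g : Matrix (Fin n) (Fin n) k} (hg : IsUnit g.det)
    {I : Ideal (MvPolynomial (Fin n) k)} {L : Submodule k (MvPolynomial (Fin n) k)} {e r : ℕ}
    (hL : L ≤ homogeneousSubmodule (Fin n) k 1) (he : Module.finrank k L ≤ e)
    (h : homogeneousSubmodule (Fin n) k (r + 1) ≤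
      L * homogeneousSubmodule (Fin n) k r ⊔ (actI g I).restrictScalars k) : QK I e r := by
  have hLfin : FiniteDimensional k L := Submodule.finiteDimensional_of_le hL
  have hg' : IsUnit (g⁻¹).det := Matrix.isUnit_nonsing_inv_det g hg
  refine ⟨L.map (act g⁻¹).toLinearMap, ?_, (Submodule.finrank_map_le _ _).trans he, ?_⟩
  · rintro _ ⟨w, hw, rfl⟩
    exact act_homog _ (hL hw)
  · have := incl_act hg' h
    rw [← actI_mul, Matrix.nonsing_inv_mul _ hg] at this
    have h1 : actI 1 I = I := by
      rw [actI, act_one]; exact Ideal.map_id I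
    rwa [h1] at this

/-- Exponents of degree `d`. -/
abbrev Ex (n d : ℕ) := {a : Fin n →₀ ℕ // a.degree = d}

instance (d : ℕ) : Finite (Ex n d) := by
  have : Set.Finite {a : Fin n →₀ ℕ | a.degree = d} := by
    refine (Set.Finite.subset (Finset.finite_toSet (Finset.finsuppAntidiag Finset.univ d)) ?_)
    intro a ha
    simp only [Finset.mem_coe, Finset.mem_finsuppAntidiag, Finset.subset_univ, and_true]
    rw [← Finsupp.degree_eq_sum]; exact ha
  exact this

instance (d : ℕ) : Fintype (Ex n d) := Fintype.ofFinite _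

theorem homog_ext {d : ℕ} {f g : MvPolynomial (Fin n) k} (hf : f.IsHomogeneous d)
    (hg : g.IsHomogeneous d) (h : ∀ a : Ex n d, coeff a.1 f = coeff a.1 g) : f = g := by
  ext a
  by_cases ha : a.degree = d
  · exact h ⟨a, ha⟩
  · rw [hf.coeff_eq_zero ha, hg.coeff_eq_zero ha]

theorem homog_sum {d : ℕ} {f : MvPolynomial (Fin n) k} (hf : f.IsHomogeneous d) :
    f = ∑ a : Ex n d, coeff a.1 f • monomial a.1 (1 : k) := by
  classical
  refine homog_ext hf (IsHomogeneous.sum _ _ _ fun a _ => ?_) ?_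
  · rw [smul_monomial]; exact isHomogeneous_monomial _ a.2
  · intro a
    rw [coeff_sum, Finset.sum_eq_single a]
    · simp
    · intro b _ hb
      rw [coeff_smul, coeff_monomial, if_neg (fun h => hb (Subtype.ext h))]; simp
    · simp

theorem homog_le_of_det {d : ℕ} {T : Submodule k (MvPolynomial (Fin n) k)}
    (h : ∀ a : Ex n d, monomial a.1 (1 : k) ∈ T) : homogeneousSubmodule (Fin n) k d ≤ T := by
  intro f hf
  rw [homog_sum hf]
  exact Submodule.sum_mem _ fun a _ => T.smul_mem _ (h a)

open Classical in
theorem span_of_det {d : ℕ} {T : Submodule k (MvPolynomial (Fin n) k)}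
    (v : Ex n d → MvPolynomial (Fin n) k) (hv : ∀ a, (v a).IsHomogeneous d)
    (hT : ∀ a, v a ∈ T)
    (hdet : (Matrix.of fun b a : Ex n d => coeff b.1 (v a)).det ≠ 0) :
    homogeneousSubmodule (Fin n) k d ≤ T := by
  set M : Matrix (Ex n d) (Ex n d) k := Matrix.of fun b a : Ex n d => coeff b.1 (v a) with hM
  apply homog_le_of_det
  intro a
  have : monomial a.1 (1 : k) = ∑ c, M⁻¹ c a • v c := by
    refine homog_ext (isHomogeneous_monomial _ a.2) (IsHomogeneous.sum _ _ _ fun c _ => ?_) ?_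
    · exact (homogeneousSubmodule (Fin n) k d).smul_mem _ (hv c)
    · intro b
      rw [coeff_sum]
      have h1 : (M * M⁻¹) b a = (1 : Matrix (Ex n d) (Ex n d) k) b a := by
        rw [Matrix.mul_nonsing_inv _ (isUnit_iff_ne_zero.mpr hdet)]
      rw [Matrix.mul_apply, Matrix.one_apply] at h1
      rw [coeff_monomial]
      have h2 : ∑ x, coeff b.1 (M⁻¹ x a • v x) = ∑ j, M b j * M⁻¹ j a := by
        refine Finset.sum_congr rfl fun x _ => ?_
        rw [coeff_smul, smul_eq_mul, mul_comm]; rfl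
      rw [h2, h1]
      simp only [Subtype.ext_iff, eq_comm]
  rw [this]
  exact Submodule.sum_mem _ fun c _ => T.smul_mem _ (hT c)

theorem adeg_eq (a : Fin n →₀ ℕ) : adeg a = a.degree := (Finsupp.degree_eq_sum a).symm

theorem drlt_add {a b : Fin n →₀ ℕ} (c : Fin n →₀ ℕ) (h : drlt a b) :
    drlt (c + a) (c + b) := by
  unfold drlt at *
  rw [adeg_eq, adeg_eq] at *
  rw [map_add, map_add]
  rcases h with h | ⟨h, i, hi, hj⟩
  · left; omega
  · right
    refine ⟨by omega, i, ?_, ?_⟩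
    · simpa using hi
    · intro j hij
      simpa using hj j hij

theorem inIdealW_eq (K : Ideal (MvPolynomial (Fin n) k)) :
    inIdealW drlt K = Ideal.span ((fun s => monomial s (1 : k)) ''
      {a | ∃ f ∈ K, IsLeadExp drlt f a}) := by
  unfold inIdealW
  congr 1
  ext m
  constructor
  · rintro ⟨f, a, hf, hfa, rfl⟩
    exact ⟨a, ⟨f, hf, hfa⟩, rfl⟩
  · rintro ⟨a, ⟨f, hf, hfa⟩, rfl⟩
    exact ⟨f, a, hf, hfa, rfl⟩

theorem mem_inIdealW {K : Ideal (MvPolynomial (Fin n) k)} {x : MvPolynomial (Fin n) k} :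
    x ∈ inIdealW drlt K ↔ ∀ b ∈ x.support, ∃ c, (∃ f ∈ K, IsLeadExp drlt f c) ∧ c ≤ b := by
  rw [inIdealW_eq, mem_ideal_span_monomial_image]
  rfl

theorem inIdealW_homog (K : Ideal (MvPolynomial (Fin n) k)) : IsHomog (inIdealW drlt K) := by
  intro f hf d
  rw [mem_inIdealW] at *
  intro b hb
  apply hf b
  rw [mem_support_iff, coeff_homogeneousComponent] at hb
  rw [mem_support_iff]
  intro h
  apply hb
  rw [h, ite_self]

theorem exists_lead {K : Ideal (MvPolynomial (Fin n) k)} (hK : IsHomog K)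
    {x : MvPolynomial (Fin n) k} (hx : x ∈ inIdealW drlt K) {b : Fin n →₀ ℕ}
    (hb : b ∈ x.support) :
    ∃ F ∈ K, F.IsHomogeneous b.degree ∧ coeff b F = 1 ∧
      ∀ b', coeff b' F ≠ 0 → b' ≠ b → drlt b' b := by
  obtain ⟨c, ⟨f, hf, hfc, hlead⟩, hcb⟩ := mem_inIdealW.mp hx b hb
  obtain ⟨e, rfl⟩ : ∃ e, b = e + c := ⟨b - c, (tsub_add_cancel_of_le hcb).symm⟩
  have hfc' : coeff c f ≠ 0 := mem_support_iff.mp hfc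
  refine ⟨monomial e (coeff c f)⁻¹ * homogeneousComponent c.degree f,
    K.mul_mem_left _ (hK f hf _), ?_, ?_, ?_⟩
  · rw [map_add]
    exact (isHomogeneous_monomial _ rfl).mul (homogeneousComponent_isHomogeneous _ _)
  · rw [coeff_monomial_mul, coeff_homogeneousComponent, if_pos rfl]
    exact inv_mul_cancel₀ hfc'
  · intro b' hb' hne
    rw [coeff_monomial_mul'] at hb'
    split_ifs at hb' with h
    · obtain ⟨c', rfl⟩ : ∃ c', b' = e + c' := ⟨b' - e, (add_tsub_cancel_of_le h).symm⟩
      apply drlt_add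
      apply hlead
      · rw [mem_support_iff]
        intro h0
        apply hb'
        rw [add_tsub_cancel_left, coeff_homogeneousComponent, h0, ite_self, mul_zero]
      · rintro rfl; exact hne rfl
    · exact absurd rfl hb'

end PartC

section PartC2
variable {k : Type*} [Field k] {n : ℕ}

/-- The weight used for degenerating. -/
def wt (B : ℕ) (b : Fin n →₀ ℕ) : ℕ := ∑ j, b j * B ^ (j : ℕ)

theorem wt_lt {d : ℕ} {b b' : Fin n →₀ ℕ} (hb : b.degree = d) (hb' : b'.degree = d)
    (h : drlt b' b) : wt (d + 1) b < wt (d + 1) b' := by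
  unfold drlt at h
  rw [adeg_eq, adeg_eq] at h
  rcases h with h | ⟨-, i, hi, hj⟩
  · omega
  set B := d + 1 with hB
  have hBpos : 0 < B := by omega
  have h1 : B * ∑ j with j < i, b j * B ^ (j : ℕ) < B * B ^ (i : ℕ) := by
    calc B * ∑ j with j < i, b j * B ^ (j : ℕ)
        = ∑ j with j < i, b j * B ^ ((j : ℕ) + 1) := by
          rw [Finset.mul_sum]
          exact Finset.sum_congr rfl fun j _ => by ring
      _ ≤ ∑ j with j < i, b j * B ^ (i : ℕ) := by
          refine Finset.sum_le_sum fun j hj => Nat.mul_le_mul_left _ ?_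
          refine Nat.pow_le_pow_right hBpos ?_
          have := (Finset.mem_filter.mp hj).2
          exact this
      _ = (∑ j with j < i, b j) * B ^ (i : ℕ) := by rw [Finset.sum_mul]
      _ ≤ d * B ^ (i : ℕ) := by
          refine Nat.mul_le_mul_right _ ?_
          rw [← hb, Finsupp.degree_eq_sum]
          exact Finset.sum_le_sum_of_subset (Finset.filter_subset _ _)
      _ < B * B ^ (i : ℕ) := Nat.mul_lt_mul_of_pos_right (by omega) (by positivity)
  have h2 := Nat.lt_of_mul_lt_mul_left h1
  have h3 : ∑ j with ¬ j < i, b j * B ^ (j : ℕ) + B ^ (i : ℕ) ≤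
      ∑ j with ¬ j < i, b' j * B ^ (j : ℕ) := by
    have : ∑ j with ¬ j < i, (if j = i then B ^ (i : ℕ) else 0) = B ^ (i : ℕ) := by
      rw [Finset.sum_ite_eq' _ i]
      simp
    rw [← this, ← Finset.sum_add_distrib]
    refine Finset.sum_le_sum fun j hj' => ?_
    have hj' := (Finset.mem_filter.mp hj').2
    split_ifs with hji
    · subst hji
      calc b j * B ^ (j : ℕ) + B ^ (j : ℕ) = (b j + 1) * B ^ (j : ℕ) := by ring
        _ ≤ _ := Nat.mul_le_mul_right _ hi
    · rw [hj j (by omega)]; simp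
  unfold wt
  rw [← Finset.sum_filter_add_sum_filter_not _ (fun j => j < i) (fun j => b j * B ^ (j : ℕ)),
    ← Finset.sum_filter_add_sum_filter_not _ (fun j => j < i) (fun j => b' j * B ^ (j : ℕ))]
  omega

theorem coeff_act_diag (c : Fin n → k) (f : MvPolynomial (Fin n) k) (b : Fin n →₀ ℕ) :
    coeff b (act (Matrix.diagonal c) f) = (∏ j, c j ^ b j) * coeff b f := by
  classical
  have hX : ∀ j, act (Matrix.diagonal c) (X j) = C (c j) * X j := by
    intro j
    rw [act_X, Finset.sum_eq_single j]
    · simp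
    · intro i _ hij; simp [Matrix.diagonal_apply_ne _ hij]
    · simp
  induction f using MvPolynomial.induction_on' with
  | monomial a s =>
    have : act (Matrix.diagonal c) (monomial a s) = monomial a ((∏ j, c j ^ a j) * s) := by
      rw [monomial_eq, Finsupp.prod_fintype _ _ (by simp), map_mul, map_prod, algHom_C]
      simp only [map_pow, hX, mul_pow]
      rw [Finset.prod_mul_distrib, monomial_eq, Finsupp.prod_fintype _ _ (by simp)]
      simp only [map_mul, map_prod, map_pow, algebraMap_eq]
      ring
    rw [this, coeff_monomial, coeff_monomial]
    split_ifs with h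
    · rw [h]
    · simp
  | add p q hp hq => rw [map_add, coeff_add, coeff_add, hp, hq, mul_add]

open Classical in
theorem QK_of_inIdeal [Infinite k] {I : Ideal (MvPolynomial (Fin n) k)} (hI : IsHomog I)
    {g : Matrix (Fin n) (Fin n) k} (hg : IsUnit g.det) {e r : ℕ}
    (h : QK (inIdealW drlt (actI g I)) e r) : QK I e r := by
  obtain ⟨L, hL, he, hLr⟩ := h
  set K := actI g I with hKdef
  have hK : IsHomog K := actI_homog hg hI
  set d := r + 1 with hd
  have hLd : L * homogeneousSubmodule (Fin n) k r ≤ homogeneousSubmodule (Fin n) k d := by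
    refine (mul_le_mul' hL le_rfl).trans ?_
    rw [Submodule.mul_le]
    intro p hp q hq
    have := IsHomogeneous.mul hp hq
    rw [add_comm] at this
    exact this
  have h1 : ∀ a : Ex n d, ∃ u ∈ L * homogeneousSubmodule (Fin n) k r,
      ∃ j ∈ inIdealW drlt K, u + j = monomial a.1 (1 : k) := by
    intro a
    obtain ⟨u, hu, v, hv, huv⟩ := Submodule.mem_sup.mp (hLr (isHomogeneous_monomial 1 a.2))
    exact ⟨u, hu, v, hv, huv⟩
  choose u hu j hj huj using h1
  have huh : ∀ a, (u a).IsHomogeneous d := fun a => hLd (hu a)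
  have hF : ∀ b : Ex n d, ∃ F ∈ K, F.IsHomogeneous d ∧ ((∃ a, coeff b.1 (j a) ≠ 0) →
      coeff b.1 F = 1 ∧ ∀ b', coeff b' F ≠ 0 → b' ≠ b.1 → drlt b' b.1) := by
    intro b
    by_cases hb : ∃ a, coeff b.1 (j a) ≠ 0
    · obtain ⟨a, ha⟩ := hb
      obtain ⟨F, hF, h1, h2, h3⟩ := exists_lead hK (hj a) (mem_support_iff.mpr ha)
      rw [b.2] at h1
      exact ⟨F, hF, h1, fun _ => ⟨h2, h3⟩⟩
    · exact ⟨0, zero_mem _, isHomogeneous_zero _ _ _, fun h => absurd h hb⟩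
  choose F hFK hFh hFl using hF
  let v : (Fin n →₀ ℕ) → ℕ := wt (d + 1)
  -- polynomial matrix
  let N : Matrix (Ex n d) (Ex n d) (Polynomial k) := Matrix.of fun b' a =>
    Polynomial.C (coeff b'.1 (u a)) +
      ∑ b : Ex n d, Polynomial.C (coeff b.1 (j a) * coeff b'.1 (F b)) *
        Polynomial.X ^ (v b'.1 - v b.1)
  have hN0 : (Polynomial.evalRingHom 0).mapMatrix N = 1 := by
    ext b' a
    rw [RingHom.mapMatrix_apply, Matrix.map_apply]
    simp only [N, Matrix.of_apply, Polynomial.coe_evalRingHom, Polynomial.eval_add,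
      Polynomial.eval_C, Polynomial.eval_finsetSum, Polynomial.eval_mul, Polynomial.eval_pow,
      Polynomial.eval_X]
    rw [Finset.sum_eq_single b']
    · have h1 : coeff b'.1 (j a) * coeff b'.1 (F b') = coeff b'.1 (j a) := by
        by_cases h0 : coeff b'.1 (j a) = 0
        · simp [h0]
        · rw [(hFl b' ⟨a, h0⟩).1, mul_one]
      rw [h1, Nat.sub_self, pow_zero, mul_one, ← coeff_add, huj, coeff_monomial,
        Matrix.one_apply]
      simp only [Subtype.ext_iff, eq_comm]
    · intro b _ hb
      by_cases h0 : coeff b.1 (j a) = 0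
      · simp [h0]
      by_cases h2 : coeff b'.1 (F b) = 0
      · simp [h2]
      have := wt_lt b.2 b'.2 ((hFl b ⟨a, h0⟩).2 b'.1 h2 (fun h => hb (Subtype.ext h.symm)))
      rw [zero_pow (by simp only [v]; omega), mul_zero]
    · simp
  have hdetN : N.det * Polynomial.X ≠ 0 := by
    refine mul_ne_zero (fun h0 => ?_) Polynomial.X_ne_zero
    have := RingHom.map_det (Polynomial.evalRingHom (0 : k)) N
    rw [hN0, h0, map_zero, Matrix.det_one] at this
    exact zero_ne_one this
  obtain ⟨t, ht⟩ : ∃ t, Polynomial.eval t (N.det * Polynomial.X) ≠ 0 := by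
    by_contra hcon
    push Not at hcon
    exact hdetN (Polynomial.funext fun t => by rw [hcon t, Polynomial.eval_zero])
  rw [Polynomial.eval_mul, Polynomial.eval_X] at ht
  have ht0 : t ≠ 0 := right_ne_zero_of_mul ht
  have htN := left_ne_zero_of_mul ht
  set D : Matrix (Fin n) (Fin n) k := Matrix.diagonal fun i => t ^ ((d + 1) ^ (i : ℕ)) with hD
  have hDu : IsUnit D.det := by
    rw [hD, Matrix.det_diagonal, isUnit_iff_ne_zero]
    exact Finset.prod_ne_zero_iff.mpr fun i _ => pow_ne_zero _ ht0
  have hDc : ∀ f b, coeff b (act D f) = t ^ (v b) * coeff b f := by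
    intro f b
    rw [hD, coeff_act_diag]
    congr 1
    simp only [v, wt]
    rw [← Finset.prod_pow_eq_pow_sum]
    refine Finset.prod_congr rfl fun i _ => ?_
    rw [← pow_mul, mul_comm]
  refine QK_of_actI (g := D * g) (L := L) ?_ hL he ?_
  · rw [Matrix.det_mul]; exact hDu.mul hg
  rw [actI_mul, ← hKdef]
  refine span_of_det (fun a => u a + ∑ b : Ex n d, (coeff b.1 (j a) * (t ^ v b.1)⁻¹) •
    act D (F b)) ?_ ?_ ?_
  · intro a
    refine (huh a).add (IsHomogeneous.sum _ _ _ fun b _ => ?_)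
    exact (homogeneousSubmodule (Fin n) k d).smul_mem _ (act_homog D (hFh b))
  · intro a
    refine Submodule.add_mem_sup (hu a) (Submodule.sum_mem _ fun b _ => ?_)
    exact Submodule.smul_mem _ _ (Ideal.mem_map_of_mem _ (hFK b))
  · rw [← Polynomial.coe_evalRingHom, RingHom.map_det] at htN
    convert htN using 2
    ext b' a
    rw [RingHom.mapMatrix_apply, Matrix.map_apply]
    simp only [N, Matrix.of_apply, Polynomial.coe_evalRingHom, Polynomial.eval_add,
      Polynomial.eval_C, Polynomial.eval_finsetSum, Polynomial.eval_mul, Polynomial.eval_pow,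
      Polynomial.eval_X]
    rw [coeff_add, coeff_sum]
    congr 1
    refine Finset.sum_congr rfl fun b _ => ?_
    rw [coeff_smul, hDc, smul_eq_mul]
    by_cases h0 : coeff b.1 (j a) = 0
    · simp [h0]
    by_cases h2 : coeff b'.1 (F b) = 0
    · simp [h2]
    have hle : v b.1 ≤ v b'.1 := by
      by_cases hb : b' = b
      · rw [hb]
      · exact (wt_lt b.2 b'.2 ((hFl b ⟨a, h0⟩).2 b'.1 h2 (fun h => hb (Subtype.ext h)))).le
    rw [pow_sub₀ _ ht0 hle]
    ring

end PartC2

section PartC3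
variable {k : Type*} [Field k] {n : ℕ}

/-- The span of the last `e` variables. -/
def L0 (k : Type*) [Field k] (n e : ℕ) : Submodule k (MvPolynomial (Fin n) k) :=
  Submodule.span k (X '' {i : Fin n | n ≤ i + e})

theorem L0_le (e : ℕ) : L0 k n e ≤ homogeneousSubmodule (Fin n) k 1 := by
  rw [L0, Submodule.span_le]
  rintro _ ⟨i, -, rfl⟩
  exact isHomogeneous_X k i

theorem L0_finrank (e : ℕ) : Module.finrank k (L0 k n e) ≤ e := by
  classical
  have h1 : L0 k n e = Submodule.span k
      (((Finset.univ.filter fun i : Fin n => n ≤ i + e).image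
        (X : Fin n → MvPolynomial (Fin n) k) : Finset _) : Set (MvPolynomial (Fin n) k)) := by
    rw [L0]; congr 1; ext x; simp
  rw [h1]
  refine (finrank_span_finset_le_card _).trans (Finset.card_image_le.trans ?_)
  have h2 : (Finset.univ.filter fun i : Fin n => n ≤ i + e).card ≤ (Finset.range e).card := by
    refine Finset.card_le_card_of_injOn (fun i => n - 1 - (i : ℕ)) ?_ ?_
    · intro i hi
      have := (Finset.mem_filter.mp hi).2
      have := i.2
      simp only [Finset.coe_range, Set.mem_Iio]
      omega
    · intro i _ j _ hij
      have := i.2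
      have := j.2
      simp only at hij
      exact Fin.ext (by omega)
  simpa using h2

/-- Linear form attached to a coefficient vector. -/
def linF (k : Type*) [Field k] (n : ℕ) : (Fin n → k) →ₗ[k] MvPolynomial (Fin n) k :=
  Fintype.linearCombination k (X : Fin n → MvPolynomial (Fin n) k)

theorem linF_apply (c : Fin n → k) : linF k n c = ∑ i, c i • X i := rfl

theorem linF_inj : Function.Injective (linF k n) := by
  classical
  intro c c' h
  funext i
  have := congrArg (coeff (Finsupp.single i 1)) h
  simpa [linF_apply, coeff_sum, coeff_X, Finsupp.single_left_inj] using this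

theorem act_linF (g : Matrix (Fin n) (Fin n) k) (c : Fin n → k) :
    act g (linF k n c) = linF k n (g.mulVec c) := by
  rw [linF_apply, linF_apply, map_sum]
  simp only [map_smul, act_X, Finset.smul_sum, Matrix.mulVec, dotProduct, Finset.sum_smul]
  rw [Finset.sum_comm]
  refine Finset.sum_congr rfl fun i _ => Finset.sum_congr rfl fun l _ => ?_
  rw [C_mul', smul_smul, mul_comm]

theorem exists_mat (E : Submodule k (Fin n → k)) :
    ∃ g : Matrix (Fin n) (Fin n) k, IsUnit g.det ∧
      ∀ c ∈ E, ∀ i : Fin n, (i : ℕ) + Module.finrank k E < n → g.mulVec c i = 0 := by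
  classical
  obtain ⟨E', hE⟩ := Submodule.exists_isCompl E
  let b := ((Module.finBasis k E').prod (Module.finBasis k E)).map
    (Submodule.prodEquivOfIsCompl E' E hE.symm)
  have hn : Module.finrank k E' + Module.finrank k E = n := by
    rw [add_comm, Submodule.finrank_add_eq_of_isCompl hE]; simp
  let σ : Fin (Module.finrank k E') ⊕ Fin (Module.finrank k E) ≃ Fin n :=
    finSumFinEquiv.trans (finCongr hn)
  let b' := b.reindex σ
  refine ⟨LinearMap.toMatrix' b'.equivFun.toLinearMap, ?_, ?_⟩
  · exact LinearEquiv.isUnit_det' b'.equivFun |> fun h => by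
      rwa [LinearMap.det_toMatrix']
  · intro c hc i hi
    rw [← Matrix.toLin'_apply, Matrix.toLin'_toMatrix']
    have hi' : (i : ℕ) < Module.finrank k E' := by omega
    have hσ : σ.symm i = Sum.inl ⟨i, hi'⟩ := by
      rw [Equiv.symm_apply_eq]
      apply Fin.ext
      simp [σ]
    have h1 : (Submodule.prodEquivOfIsCompl E' E hE.symm).symm c = (0, ⟨c, hc⟩) := by
      rw [LinearEquiv.symm_apply_eq]; simp
    simp [b', hσ, b, h1]

theorem exists_act_le {L : Submodule k (MvPolynomial (Fin n) k)}
    (hL : L ≤ homogeneousSubmodule (Fin n) k 1) {e : ℕ} (he : Module.finrank k L ≤ e) :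
    ∃ g : Matrix (Fin n) (Fin n) k, IsUnit g.det ∧ L.map (act g).toLinearMap ≤ L0 k n e := by
  have hLfin : FiniteDimensional k L := Submodule.finiteDimensional_of_le hL
  obtain ⟨g, hg, hgE⟩ := exists_mat (L.comap (linF k n))
  have hfr : Module.finrank k (L.comap (linF k n)) ≤ e := by
    refine le_trans ?_ he
    rw [LinearEquiv.finrank_eq (Submodule.equivMapOfInjective (linF k n) linF_inj _)]
    exact Submodule.finrank_mono (Submodule.map_comap_le _ _)
  refine ⟨g, hg, ?_⟩
  rintro _ ⟨l, hl, rfl⟩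
  have h1 : l ∈ LinearMap.range (linF k n) := by
    have := hL hl
    rw [homogeneousSubmodule_one_eq_span_X] at this
    rwa [linF, Fintype.range_linearCombination]
  obtain ⟨c, rfl⟩ := h1
  rw [AlgHom.toLinearMap_apply, act_linF, linF_apply]
  refine Submodule.sum_mem _ fun i _ => ?_
  by_cases hi : n ≤ i + e
  · exact Submodule.smul_mem _ _ (Submodule.subset_span ⟨i, hi, rfl⟩)
  · rw [hgE c hl i (by omega), zero_smul]
    exact zero_mem _

/-- Generic change of coordinates. -/
def actGen (k : Type*) [Field k] (n : ℕ) :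
    MvPolynomial (Fin n) k →+* MvPolynomial (Fin n) (MvPolynomial (Fin n × Fin n) k) :=
  eval₂Hom (C.comp C) fun j => ∑ i, C (X (i, j)) * X i

theorem actGen_eval (g : Matrix (Fin n) (Fin n) k) (f : MvPolynomial (Fin n) k) :
    MvPolynomial.map (eval fun q : Fin n × Fin n => g q.1 q.2) (actGen k n f) = act g f := by
  have : (MvPolynomial.map (eval fun q : Fin n × Fin n => g q.1 q.2)).comp (actGen k n) =
      (act g : MvPolynomial (Fin n) k →+* MvPolynomial (Fin n) k) := by
    apply ringHom_ext
    · intro c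
      simp [actGen]
    · intro j
      simp [actGen, act_X]
  exact congrArg (fun φ => φ f) this

theorem L0_mul_le (e r : ℕ) : L0 k n e * homogeneousSubmodule (Fin n) k r ≤
    homogeneousSubmodule (Fin n) k (r + 1) := by
  refine (mul_le_mul' (L0_le e) le_rfl).trans ?_
  rw [Submodule.mul_le]
  intro p hp q hq
  have := IsHomogeneous.mul hp hq
  rw [add_comm] at this
  exact this

theorem L0_mul_supp {e r : ℕ} {u : MvPolynomial (Fin n) k}
    (hu : u ∈ L0 k n e * homogeneousSubmodule (Fin n) k r) :
    ∀ b ∈ u.support, ∃ i : Fin n, n ≤ i + e ∧ b i ≠ 0 := by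
  have h1 : L0 k n e * homogeneousSubmodule (Fin n) k r ≤
      (Ideal.span (X '' {i : Fin n | n ≤ i + e}) :
        Ideal (MvPolynomial (Fin n) k)).restrictScalars k := by
    rw [Submodule.mul_le]
    intro p hp q _
    have h2 : L0 k n e ≤ (Ideal.span (X '' {i : Fin n | n ≤ i + e}) :
        Ideal (MvPolynomial (Fin n) k)).restrictScalars k := by
      rw [L0, Submodule.span_le]
      exact fun x hx => Ideal.subset_span hx
    exact Ideal.mul_mem_right _ _ (h2 hp)
  intro b hb
  obtain ⟨i, hi, hi'⟩ := mem_ideal_span_X_image.mp (h1 hu) b hb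
  exact ⟨i, hi, hi'⟩

open Classical in
theorem exists_generic [Infinite k] {I : Ideal (MvPolynomial (Fin n) k)} {e r : ℕ}
    (h : QK I e r) (p : MvPolynomial (Fin n × Fin n) k) (hp : p ≠ 0) :
    ∃ g : Matrix (Fin n) (Fin n) k, IsUnit g.det ∧ eval (fun q => g q.1 q.2) p ≠ 0 ∧
      homogeneousSubmodule (Fin n) k (r + 1) ≤
        L0 k n e * homogeneousSubmodule (Fin n) k r ⊔ (actI g I).restrictScalars k := by
  obtain ⟨L, hL, he, hLr⟩ := h
  obtain ⟨g0, hg0, hg0L⟩ := exists_act_le hL he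
  set d := r + 1 with hd
  have h1 := incl_act hg0 hLr
  have h2 : ∀ a : Ex n d, ∃ u ∈ L0 k n e * homogeneousSubmodule (Fin n) k r,
      ∃ f ∈ I, u + act g0 f = monomial a.1 (1 : k) := by
    intro a
    obtain ⟨u, hu, v, hv, huv⟩ := Submodule.mem_sup.mp (h1 (isHomogeneous_monomial 1 a.2))
    refine ⟨u, mul_le_mul' hg0L le_rfl hu, act g0⁻¹ v, (mem_actI hg0).mp hv, ?_⟩
    rw [act_act_inv hg0, huv]
  choose u hu f hf huf using h2
  have huh : ∀ a, (u a).IsHomogeneous d := fun a => L0_mul_le e r (hu a)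
  have hfh : ∀ a, (f a).IsHomogeneous d := by
    intro a
    have : f a = act g0⁻¹ (monomial a.1 (1 : k) - u a) := by
      rw [← huf a, add_sub_cancel_left, act_inv_act hg0]
    rw [this]
    exact act_homog _ ((isHomogeneous_monomial 1 a.2).sub (huh a))
  let N : Matrix (Ex n d) (Ex n d) (MvPolynomial (Fin n × Fin n) k) := Matrix.of fun b a =>
    C (coeff b.1 (u a)) + coeff b.1 (actGen k n (f a))
  have hN : ∀ g : Matrix (Fin n) (Fin n) k,
      (eval fun q : Fin n × Fin n => g q.1 q.2).mapMatrix N =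
      Matrix.of fun b a : Ex n d => coeff b.1 (u a + act g (f a)) := by
    intro g
    ext b a
    rw [RingHom.mapMatrix_apply, Matrix.map_apply]
    simp only [N, Matrix.of_apply, map_add, eval_C, coeff_add]
    rw [← actGen_eval, coeff_map]
  have hNdet : N.det ≠ 0 := by
    intro h0
    have h3 := RingHom.map_det (eval fun q : Fin n × Fin n => g0 q.1 q.2) N
    have h4 : (Matrix.of fun b a : Ex n d => coeff b.1 (u a + act g0 (f a))) = 1 := by
      ext b a
      rw [Matrix.of_apply, huf, coeff_monomial, Matrix.one_apply]
      simp only [Subtype.ext_iff, eq_comm]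
    rw [hN, h0, map_zero, h4, Matrix.det_one] at h3
    exact zero_ne_one h3
  let Dm : Matrix (Fin n) (Fin n) (MvPolynomial (Fin n × Fin n) k) :=
    Matrix.of fun i j => X (i, j)
  have hDm : ∀ g : Matrix (Fin n) (Fin n) k,
      (eval fun q : Fin n × Fin n => g q.1 q.2).mapMatrix Dm = g := by
    intro g
    ext i j
    simp [Dm]
  have hDdet : Dm.det ≠ 0 := by
    intro h0
    have h3 := RingHom.map_det (eval fun q : Fin n × Fin n =>
      (1 : Matrix (Fin n) (Fin n) k) q.1 q.2) Dm
    rw [hDm, h0, map_zero, Matrix.det_one] at h3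
    exact zero_ne_one h3
  obtain ⟨x, hx⟩ : ∃ x, eval x (N.det * Dm.det * p) ≠ 0 := by
    by_contra hcon
    push Not at hcon
    exact mul_ne_zero (mul_ne_zero hNdet hDdet) hp
      (MvPolynomial.funext fun x => by rw [hcon x, map_zero])
  let g : Matrix (Fin n) (Fin n) k := Matrix.of fun i j => x (i, j)
  have hxg : x = fun q : Fin n × Fin n => g q.1 q.2 := rfl
  rw [map_mul, map_mul, hxg, RingHom.map_det, RingHom.map_det, hN, hDm] at hx
  refine ⟨g, isUnit_iff_ne_zero.mpr (right_ne_zero_of_mul (left_ne_zero_of_mul hx)),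
    right_ne_zero_of_mul hx, ?_⟩
  refine span_of_det (fun a => u a + act g (f a)) (fun a => (huh a).add (act_homog g (hfh a)))
    (fun a => Submodule.add_mem_sup (hu a) (Ideal.mem_map_of_mem _ (hf a)))
    (left_ne_zero_of_mul (left_ne_zero_of_mul hx))

theorem drlt_of_last {e : ℕ} {a b : Fin n →₀ ℕ} (hdeg : b.degree = a.degree)
    (ha : ∀ i : Fin n, n ≤ i + e → a i = 0) (hb : ∃ i : Fin n, n ≤ i + e ∧ b i ≠ 0) :
    drlt b a := by
  classical
  obtain ⟨i0, hi0, hbi0⟩ := hb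
  right
  refine ⟨by rw [adeg_eq, adeg_eq, hdeg], ?_⟩
  let s := Finset.univ.filter fun i => b i ≠ a i
  have hs : i0 ∈ s := by simp [s, ha i0 hi0, hbi0]
  have hne : s.Nonempty := ⟨i0, hs⟩
  have hmem := s.max'_mem hne
  have hle := s.le_max' i0 hs
  refine ⟨s.max' hne, ?_, ?_⟩
  · have h1 := (Finset.mem_filter.mp hmem).2
    have h2 : a (s.max' hne) = 0 := ha _ (by
      have : (i0 : ℕ) ≤ (s.max' hne : Fin n) := hle
      omega)
    rw [h2] at h1 ⊢
    omega
  · intro j hj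
    by_contra hcon
    have : j ∈ s := by simp [s, hcon]
    exact absurd (s.le_max' j this) (not_le.mpr hj)

theorem incl_inIdeal {K : Ideal (MvPolynomial (Fin n) k)} {e r : ℕ}
    (h : homogeneousSubmodule (Fin n) k (r + 1) ≤
        L0 k n e * homogeneousSubmodule (Fin n) k r ⊔ K.restrictScalars k) :
    QK (inIdealW drlt K) e r := by
  classical
  refine ⟨L0 k n e, L0_le e, L0_finrank e, homog_le_of_det fun a => ?_⟩
  by_cases ha : ∀ i : Fin n, n ≤ i + e → a.1 i = 0
  · obtain ⟨u, hu, f, hf, huf⟩ := Submodule.mem_sup.mp (h (isHomogeneous_monomial 1 a.2))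
    refine Submodule.mem_sup_right ?_
    have huh : u.IsHomogeneous (r + 1) := L0_mul_le e r hu
    have hau : coeff a.1 u = 0 := by
      by_contra h0
      obtain ⟨i, hi, hi'⟩ := L0_mul_supp hu a.1 (mem_support_iff.mpr h0)
      exact hi' (ha i hi)
    have hfe : f = monomial a.1 1 - u := by rw [← huf]; ring
    refine Ideal.subset_span ⟨f, a.1, hf, ⟨?_, ?_⟩, rfl⟩
    · rw [mem_support_iff, hfe, coeff_sub, hau]; simp
    · intro b hb hba
      have hbu : coeff b u ≠ 0 := by
        rw [mem_support_iff, hfe, coeff_sub, coeff_monomial, if_neg (Ne.symm hba)] at hb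
        simpa using hb
      refine drlt_of_last ?_ ha (L0_mul_supp hu b (mem_support_iff.mpr hbu))
      rw [a.2]
      by_contra hd
      exact hbu (huh.coeff_eq_zero hd)
  · push Not at ha
    obtain ⟨i, hi, hai⟩ := ha
    refine Submodule.mem_sup_left ?_
    have hle : Finsupp.single i 1 ≤ a.1 := by
      rw [Finsupp.single_le_iff]; omega
    obtain ⟨c, hc⟩ : ∃ c, a.1 = Finsupp.single i 1 + c :=
      ⟨a.1 - Finsupp.single i 1, (add_tsub_cancel_of_le hle).symm⟩
    have h1 : monomial a.1 (1 : k) = X i * monomial c 1 := by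
      rw [X, monomial_mul, hc, one_mul]
    rw [h1]
    refine Submodule.mul_mem_mul (Submodule.subset_span ⟨i, hi, rfl⟩)
      (isHomogeneous_monomial 1 ?_)
    have := a.2
    rw [hc, map_add, Finsupp.degree_single] at this
    omega

theorem main_aux [Infinite k] (I J : Ideal (MvPolynomial (Fin n) k))
    (hI : IsHomog I) (hgin : IsGin I J) : ringRedNum (maxIdealQ I) = ringRedNum (maxIdealQ J) := by
  obtain ⟨U, ⟨g1, hg1⟩, ⟨P, rfl⟩, hU⟩ := hgin
  have hJ := hU g1 hg1
  obtain ⟨hg1u, p, hpP, hp⟩ := hg1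
  have hp0 : p ≠ 0 := by rintro rfl; simp at hp
  refine ringRedNum_eq_of_QK hI (hJ ▸ inIdealW_homog _) fun e r => ⟨fun h => ?_, fun h => ?_⟩
  · obtain ⟨g, hgu, hgp, hgr⟩ := exists_generic h p hp0
    rw [← hU g ⟨hgu, p, hpP, hgp⟩]
    exact incl_inIdeal hgr
  · rw [← hJ] at h
    exact QK_of_inIdeal hI hg1u h

end PartC3

/-- Theorem 4.3: over an infinite field, for the generic initial ideal `J = gin(I)`
with respect to the reverse lexicographic order, `r(S/I) = r(S/gin(I))`. -/
theorem statement16 {k : Type*} [Field k] [Infinite k] {n : ℕ}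
    (I J : Ideal (MvPolynomial (Fin n) k)) (hI : IsHomog I) (hgin : IsGin I J) :
    ringRedNum (maxIdealQ I) = ringRedNum (maxIdealQ J) := by
  exact main_aux I J hI hgin
end
end Paper
end

section
/- In S = k[x_1, x_2, x_3] with the lexicographic term order and char(k) = 0, the ideal I = (x_1², x_1x_3 − x_2²) satisfies: gin(I) = (x_1², x_1x_2, x_1x_3², x_2⁴), r(S/I) = 2, and r(S/gin(I)) = 3; in particular r(S/gin(I)) > r(S/I), so the equality r(S/I) = r(S/gin(I)) fails for the lexicographic order. -/
set_option synthInstance.maxHeartbeats 1000000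
set_option maxHeartbeats 1000000

/-! Common definitions: gradings, term orders, initial ideals, generic initial ideals,
Borel-fixed ideals, filter-regular sequences, a Koszul/Čech-type description of graded
local cohomology and the invariants `a_i`, `reg_t`, `a*_t`, minimal graded free
resolutions, and reductions. -/

namespace Paper

open MvPolynomial

noncomputable section

variable {k : Type*} [Field k] {n : ℕ}

section RedHelpers

variable {R : Type*} [CommRing R]

theorem red_iter (m : Ideal R) (y : R) (r : ℕ)
    (h : m ^ (r + 1) ≤ Ideal.span {y} * m ^ r ⊔ m ^ (r + 2)) (j : ℕ) :
    m ^ (r + 1) ≤ Ideal.span {y} * m ^ r ⊔ m ^ (r + 1 + j) := by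
  induction j with
  | zero => exact le_sup_right
  | succ j ih =>
    refine ih.trans (sup_le le_sup_left ?_)
    calc m ^ (r + 1 + j) = m ^ (r + 1) * m ^ j := pow_add _ _ _
      _ ≤ (Ideal.span {y} * m ^ r ⊔ m ^ (r + 2)) * m ^ j := Ideal.mul_mono_left h
      _ = Ideal.span {y} * m ^ r * m ^ j ⊔ m ^ (r + 2) * m ^ j := Ideal.sup_mul _ _ _
      _ ≤ _ := by
        refine sup_le_sup Ideal.mul_le_left ?_
        rw [← pow_add]
        exact le_of_eq (by ring_nf)

theorem red_of_eq (m a : Ideal R) (r : ℕ) (ha : a ≤ m)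
    (h : m ^ (r + 1) ≤ a * m ^ r) (s : ℕ) (hs : r ≤ s) : m ^ (s + 1) = a * m ^ s := by
  obtain ⟨t, rfl⟩ := Nat.exists_eq_add_of_le hs
  apply le_antisymm
  · calc m ^ (r + t + 1) = m ^ (r + 1) * m ^ t := by ring
      _ ≤ a * m ^ r * m ^ t := Ideal.mul_mono_left h
      _ = a * m ^ (r + t) := by ring
  · calc a * m ^ (r + t) ≤ m * m ^ (r + t) := Ideal.mul_mono_left ha
      _ = _ := by ring

/-- Abstract computation of the reduction number. -/
theorem ringRedNum_eq_s17 (m : Ideal R) (r : ℕ) (good : R → Prop) (z : R)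
    (hgm : ∀ y, good y → y ∈ m)
    (H1 : ∀ a, IsReduction m a → ∃ y ∈ a, good y)
    (H2 : ∀ y, good y → m ^ (r + 2) ≤ Ideal.span {y} * m ^ (r + 1) ⊔ m ^ (r + 3))
    (H3 : ∀ y, good y → ¬ m ^ (r + 1) ≤ Ideal.span {y} * m ^ r ⊔ m ^ (r + 2))
    (hz : z ∈ m) (H4 : m ^ (r + 2) ≤ Ideal.span {z} * m ^ (r + 1))
    (H5 : ∀ u, good (u * z) → z ∈ Ideal.span {u * z} ⊔ m * Ideal.span {z}) :
    ringRedNum m = r + 1 := by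
  have hzm : Ideal.span {z} ≤ m := (Ideal.span_singleton_le_iff_mem _).2 hz
  have hzred : IsReduction m (Ideal.span {z}) :=
    ⟨hzm, r + 1, fun s hs => red_of_eq m _ (r + 1) hzm H4 s hs⟩
  have hzmin : IsMinimalReduction m (Ideal.span {z}) := by
    refine ⟨hzred, fun b hb hbz => le_antisymm hbz ?_⟩
    obtain ⟨y, hyb, hy⟩ := H1 b hb
    obtain ⟨u, rfl⟩ := Ideal.mem_span_singleton'.1 (hbz hyb)
    have h5 := H5 u hy
    have h6 : Ideal.span {z} ≤ b ⊔ m * Ideal.span {z} := by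
      rw [Ideal.span_singleton_le_iff_mem]
      exact sup_le_sup_right ((Ideal.span_singleton_le_iff_mem _).2 hyb) _ h5
    have h7 : ∀ j : ℕ, Ideal.span {z} ≤ b ⊔ m ^ j * Ideal.span {z} := by
      intro j
      induction j with
      | zero => simp
      | succ j ih =>
        refine ih.trans (sup_le le_sup_left ?_)
        calc m ^ j * Ideal.span {z} ≤ m ^ j * (b ⊔ m * Ideal.span {z}) := Ideal.mul_mono_right h6
          _ = m ^ j * b ⊔ m ^ j * (m * Ideal.span {z}) := Ideal.mul_sup _ _ _
          _ ≤ _ := by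
            refine sup_le_sup Ideal.mul_le_right ?_
            exact le_of_eq (by ring)
    obtain ⟨hbm, N, hN⟩ := hb
    refine (h7 (N + 1)).trans (sup_le le_rfl ?_)
    rw [hN N le_rfl]
    exact Ideal.mul_le_left.trans Ideal.mul_le_left
  have key : ∀ a, IsMinimalReduction m a → r + 1 ≤ redNum m a := by
    intro a ha
    obtain ⟨⟨ham, N, hN⟩, hmin⟩ := ha
    refine le_csInf ⟨N, hN N le_rfl⟩ ?_
    intro s hs
    by_contra hlt
    push Not at hlt
    have hs' : m ^ (r + 1) = a * m ^ r := red_of_eq m a s ham (le_of_eq hs) r (by omega)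
    obtain ⟨y, hya, hy⟩ := H1 a ⟨ham, N, hN⟩
    set M := N + 2 with hM
    have hMa : m ^ M ≤ a := by
      rw [hM, hN (N + 1) (by omega)]; exact Ideal.mul_le_left
    have hym : Ideal.span {y} ≤ m := (Ideal.span_singleton_le_iff_mem _).2 (hgm y hy)
    have hb : IsReduction m (Ideal.span {y} ⊔ m ^ M) := by
      have hle : Ideal.span {y} ⊔ m ^ M ≤ m :=
        sup_le hym (Ideal.pow_le_self (by omega))
      refine ⟨hle, r + 1, fun s hs => red_of_eq m _ (r + 1) hle ?_ s hs⟩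
      have := red_iter m y (r + 1) (H2 y hy) M
      refine this.trans ?_
      rw [Ideal.sup_mul]
      refine sup_le_sup le_rfl ?_
      rw [← pow_add]
      exact Ideal.pow_le_pow_right (by omega)
    have hba := hmin _ hb (sup_le ((Ideal.span_singleton_le_iff_mem _).2 hya) hMa)
    apply H3 y hy
    rw [hs', ← hba, Ideal.sup_mul]
    refine sup_le_sup le_rfl ?_
    rw [← pow_add]
    exact Ideal.pow_le_pow_right (by omega)
  apply le_antisymm
  · have h0 : ringRedNum m ≤ redNum m (Ideal.span {z}) := Nat.sInf_le ⟨_, hzmin, rfl⟩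
    refine h0.trans ?_
    exact Nat.sInf_le (red_of_eq m _ (r + 1) hzm H4 (r + 1) le_rfl)
  · unfold ringRedNum
    refine le_csInf ⟨_, _, hzmin, rfl⟩ ?_
    rintro s ⟨a, ha, rfl⟩
    exact key a ha

end RedHelpers

section RedConcrete

theorem sup_pow_succ_le {R : Type*} [CommRing R] (A B : Ideal R) (n : ℕ) :
    (A ⊔ B) ^ (n + 1) ≤ A ^ (n + 1) ⊔ B * (A ⊔ B) ^ n := by
  induction n with
  | zero => simp
  | succ n ih =>
    rw [pow_succ]
    refine (Ideal.mul_mono_left ih).trans ?_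
    rw [Ideal.sup_mul, Ideal.mul_sup]
    refine sup_le (sup_le ?_ ?_) ?_
    · rw [← pow_succ]; exact le_sup_left
    · refine le_trans ?_ le_sup_right
      rw [mul_comm]
      exact Ideal.mul_mono_right (pow_le_pow_left' le_sup_left _)
    · refine le_trans ?_ le_sup_right
      rw [mul_assoc, ← pow_succ]

variable {k : Type*} [Field k]

theorem sub_C_mem_maxIdeal (p : MvPolynomial (Fin 3) k) :
    ∃ c : k, p - C c ∈ maxIdeal k 3 := by
  induction p using MvPolynomial.induction_on with
  | C a => exact ⟨a, by simp⟩
  | add p q hp hq =>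
    obtain ⟨c, hc⟩ := hp
    obtain ⟨d, hd⟩ := hq
    refine ⟨c + d, ?_⟩
    have := Ideal.add_mem _ hc hd
    rw [C_add]
    convert this using 1
    ring
  | mul_X p i _ =>
    refine ⟨0, ?_⟩
    rw [C_0, sub_zero]
    exact Ideal.mul_mem_left _ _ (Ideal.subset_span ⟨i, rfl⟩)

theorem maxIdeal_eq3 : maxIdeal k 3 = Ideal.span {X 0, X 1, X 2} := by
  unfold maxIdeal
  congr 1
  ext p
  simp only [Set.mem_range, Set.mem_insert_iff, Set.mem_singleton_iff]
  constructor
  · rintro ⟨i, rfl⟩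
    fin_cases i <;> simp
  · rintro (rfl | rfl | rfl)
    exacts [⟨0, rfl⟩, ⟨1, rfl⟩, ⟨2, rfl⟩]

theorem maxIdeal_decomp (p : MvPolynomial (Fin 3) k) (hp : p ∈ maxIdeal k 3) :
    ∃ c0 c1 c2 : k, p - (C c0 * X 0 + C c1 * X 1 + C c2 * X 2) ∈ maxIdeal k 3 ^ 2 := by
  have hX : ∀ i, (X i : MvPolynomial (Fin 3) k) ∈ maxIdeal k 3 :=
    fun i => Ideal.subset_span ⟨i, rfl⟩
  rw [maxIdeal_eq3] at hp
  rw [Ideal.mem_span_insert] at hp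
  obtain ⟨a, q, hq, rfl⟩ := hp
  rw [Ideal.mem_span_pair] at hq
  obtain ⟨b, c, rfl⟩ := hq
  obtain ⟨c0, h0⟩ := sub_C_mem_maxIdeal a
  obtain ⟨c1, h1⟩ := sub_C_mem_maxIdeal b
  obtain ⟨c2, h2⟩ := sub_C_mem_maxIdeal c
  refine ⟨c0, c1, c2, ?_⟩
  rw [pow_two]
  have := Ideal.add_mem _ (Ideal.add_mem _ (Ideal.mul_mem_mul h0 (hX 0))
    (Ideal.mul_mem_mul h1 (hX 1))) (Ideal.mul_mem_mul h2 (hX 2))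
  convert this using 1
  ring

/-- The evaluation at the line `x₁ = x₂ = 0`. -/
def lineHom (k : Type*) [Field k] : MvPolynomial (Fin 3) k →+* Polynomial k :=
  (aeval (R := k) ![0, 0, (Polynomial.X : Polynomial k)]).toRingHom

theorem lineHom_X0 : lineHom k (X 0) = 0 := by simp [lineHom]
theorem lineHom_X1 : lineHom k (X 1) = 0 := by simp [lineHom]
theorem lineHom_X2 : lineHom k (X 2) = Polynomial.X := by simp [lineHom]
theorem lineHom_C (c : k) : lineHom k (C c) = Polynomial.C c := by
  simp [lineHom]

theorem lineHom_map : (maxIdeal k 3).map (lineHom k) = Ideal.span {Polynomial.X} := by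
  rw [maxIdeal_eq3, Ideal.map_span]
  apply le_antisymm
  · rw [Ideal.span_le]
    rintro _ ⟨p, (rfl | rfl | rfl), rfl⟩
    · simp [lineHom_X0]
    · simp [lineHom_X1]
    · rw [lineHom_X2]; exact Ideal.subset_span rfl
  · rw [Ideal.span_le]
    rintro _ rfl
    exact Ideal.subset_span ⟨X 2, by simp, lineHom_X2⟩

theorem ringRedNum_concrete (J : Ideal (MvPolynomial (Fin 3) k)) (r : ℕ)
    (hJ0 : ∀ p ∈ J, lineHom k p = 0)
    (hup : ∀ a b : k,
      (Ideal.span {Ideal.Quotient.mk J (X 0), Ideal.Quotient.mk J (X 1)}) ^ (r + 2) ≤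
      Ideal.span {Ideal.Quotient.mk J (X 2 - (C a * X 0 + C b * X 1))} *
        maxIdealQ J ^ (r + 1))
    (hlow : ∀ a b : k, ∃ (B : Type _) (_ : CommRing B) (f : MvPolynomial (Fin 3) k →+* B),
      (∀ p ∈ J, f p = 0) ∧ f (X 2 - (C a * X 0 + C b * X 1)) = 0 ∧
      ((maxIdeal k 3).map f) ^ (r + 2) = ⊥ ∧ ((maxIdeal k 3).map f) ^ (r + 1) ≠ ⊥) :
    ringRedNum (maxIdealQ J) = r + 1 := by
  set π := Ideal.Quotient.mk J with hπ
  set m := maxIdealQ J with hm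
  have hmdef : m = (maxIdeal k 3).map π := rfl
  have hπs : Function.Surjective π := Ideal.Quotient.mk_surjective
  let F0 : MvPolynomial (Fin 3) k ⧸ J →+* Polynomial k := Ideal.Quotient.lift J (lineHom k) hJ0
  have hF0 : ∀ p, F0 (π p) = lineHom k p := fun p => rfl
  have hF0m : m.map F0 = Ideal.span {Polynomial.X} := by
    rw [hmdef, Ideal.map_map]; exact lineHom_map
  have hX : ∀ i, π (X i) ∈ m := fun i =>
    Ideal.mem_map_of_mem _ (Ideal.subset_span ⟨i, rfl⟩)
  have hF0q : ∀ q ∈ m ^ 2, (F0 q).coeff 1 = 0 := by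
    intro q hq
    have := Ideal.mem_map_of_mem F0 hq
    rw [Ideal.map_pow, hF0m, Ideal.span_singleton_pow, Ideal.mem_span_singleton,
      Polynomial.X_pow_dvd_iff] at this
    exact this 1 (by norm_num)
  -- decomposition of elements of `m`
  have hdec : ∀ y ∈ m, ∃ c0 c1 c2 : k, ∃ q ∈ m ^ 2,
      y = π (C c0 * X 0 + C c1 * X 1 + C c2 * X 2) + q := by
    intro y hy
    rw [hmdef, Ideal.mem_map_iff_of_surjective _ hπs] at hy
    obtain ⟨p, hp, rfl⟩ := hy
    obtain ⟨c0, c1, c2, h⟩ := maxIdeal_decomp p hp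
    refine ⟨c0, c1, c2, π (p - (C c0 * X 0 + C c1 * X 1 + C c2 * X 2)), ?_, ?_⟩
    · rw [hmdef, ← Ideal.map_pow]
      exact Ideal.mem_map_of_mem _ h
    · rw [← map_add]; congr 1; ring
  let good : MvPolynomial (Fin 3) k ⧸ J → Prop := fun y => y ∈ m ∧ (F0 y).coeff 1 ≠ 0
  have hgood : ∀ y, good y → ∃ c a b : k, c ≠ 0 ∧ ∃ q ∈ m ^ 2,
      y = π (C c) * π (X 2 - (C a * X 0 + C b * X 1)) + q := by
    rintro y ⟨hy, hy1⟩
    obtain ⟨c0, c1, c2, q, hq, rfl⟩ := hdec y hy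
    have hc2 : c2 ≠ 0 := by
      intro h
      apply hy1
      rw [map_add, Polynomial.coeff_add, hF0q q hq, hF0]
      simp [lineHom_X0, lineHom_X1, h]
    refine ⟨c2, -c0 / c2, -c1 / c2, hc2, q, hq, ?_⟩
    rw [← map_mul]
    congr 2
    have e0 : (C c0 : MvPolynomial (Fin 3) k) = - (C c2 * C (-c0 / c2)) := by
      rw [← C_mul, ← C_neg]; congr 1; field_simp
    have e1 : (C c1 : MvPolynomial (Fin 3) k) = - (C c2 * C (-c1 / c2)) := by
      rw [← C_mul, ← C_neg]; congr 1; field_simp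
    rw [e0, e1]
    ring
  have hupm : ∀ a b : k, m ^ (r + 2) ≤
      Ideal.span {π (X 2 - (C a * X 0 + C b * X 1))} * m ^ (r + 1) := by
    intro a b
    have e : m = Ideal.span {π (X 0), π (X 1)} ⊔
        Ideal.span {π (X 2 - (C a * X 0 + C b * X 1))} := by
      apply le_antisymm
      · rw [hmdef, maxIdeal_eq3, Ideal.map_span, Ideal.span_le]
        rintro _ ⟨p, (rfl | rfl | rfl), rfl⟩
        · exact Ideal.mem_sup_left (Ideal.subset_span (by simp))
        · exact Ideal.mem_sup_left (Ideal.subset_span (by simp))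
        · have h : π (X 2) = (π (C a) * π (X 0) + π (C b) * π (X 1)) +
              π (X 2 - (C a * X 0 + C b * X 1)) := by
            rw [← map_mul, ← map_mul, ← map_add, ← map_add]; congr 1; ring
          rw [h]
          exact Submodule.add_mem_sup (Ideal.mem_span_pair.2 ⟨_, _, rfl⟩)
            (Ideal.subset_span rfl)
      · refine sup_le ?_ ?_
        · rw [Ideal.span_le]
          rintro _ (rfl | rfl)
          exacts [hX 0, hX 1]
        · rw [Ideal.span_singleton_le_iff_mem, map_sub, map_add, map_mul, map_mul]
          exact Ideal.sub_mem _ (hX 2) (Ideal.add_mem _ (Ideal.mul_mem_left _ _ (hX 0))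
            (Ideal.mul_mem_left _ _ (hX 1)))
    have h := sup_pow_succ_le (Ideal.span {π (X 0), π (X 1)})
      (Ideal.span {π (X 2 - (C a * X 0 + C b * X 1))}) (r + 1)
    rw [← e] at h
    exact h.trans (sup_le (hup a b) le_rfl)
  refine ringRedNum_eq_s17 m r good (π (X 2)) (fun y hy => hy.1) ?_ ?_ ?_ (hX 2) ?_ ?_
  · -- H1
    rintro a ⟨ham, N, hN⟩
    by_contra hcon
    push Not at hcon
    have h1 : a.map F0 ≤ Ideal.span {Polynomial.X ^ 2} := by
      rw [Ideal.map_le_iff_le_comap]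
      intro y hy
      rw [Ideal.mem_comap, Ideal.mem_span_singleton, Polynomial.X_pow_dvd_iff]
      have hy0 := Ideal.mem_map_of_mem F0 (ham hy)
      rw [hF0m, Ideal.mem_span_singleton, Polynomial.X_dvd_iff] at hy0
      have hy1 : (F0 y).coeff 1 = 0 := by
        by_contra h
        exact hcon y hy ⟨ham hy, h⟩
      intro d hd
      interval_cases d
      exacts [hy0, hy1]
    have h2 := congrArg (Ideal.map F0) (hN N le_rfl)
    rw [Ideal.map_pow, Ideal.map_mul, Ideal.map_pow, hF0m, Ideal.span_singleton_pow,
      Ideal.span_singleton_pow] at h2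
    have h3 : (Polynomial.X ^ (N + 1) : Polynomial k) ∈
        Ideal.span {(Polynomial.X ^ 2 : Polynomial k)} * Ideal.span {Polynomial.X ^ N} := by
      refine Ideal.mul_mono_left h1 ?_
      rw [← h2]
      exact Ideal.subset_span rfl
    rw [Ideal.span_singleton_mul_span_singleton, Ideal.mem_span_singleton, ← pow_add,
      Polynomial.X_pow_dvd_iff] at h3
    have := h3 (N + 1) (by omega)
    simp at this
  · -- H2
    intro y hy
    obtain ⟨c, a, b, hc, q, hq, hyq⟩ := hgood y hy
    refine (hupm a b).trans ?_
    have : Ideal.span {π (X 2 - (C a * X 0 + C b * X 1))} ≤ Ideal.span {y} ⊔ m ^ 2 := by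
      rw [Ideal.span_singleton_le_iff_mem]
      have e : π (X 2 - (C a * X 0 + C b * X 1)) = π (C c⁻¹) * y + (- π (C c⁻¹) * q) := by
        have hcc : π (C c⁻¹) * π (C c) = 1 := by
          rw [← map_mul, ← C_mul, inv_mul_cancel₀ hc]; simp
        rw [hyq]
        linear_combination (- π (X 2 - (C a * X 0 + C b * X 1))) * hcc
      rw [e]
      exact Submodule.add_mem_sup (Ideal.mul_mem_left _ _ (Ideal.subset_span rfl))
        (Ideal.mul_mem_left _ _ hq)
    refine (Ideal.mul_mono_left this).trans ?_
    rw [Ideal.sup_mul, ← pow_add]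
    exact sup_le_sup le_rfl (Ideal.pow_le_pow_right (by omega))
  · -- H3
    intro y hy hle
    obtain ⟨c, a, b, hc, q, hq, hyq⟩ := hgood y hy
    obtain ⟨B, _, f, hfJ, hfl, hf2, hf1⟩ := hlow a b
    let F : MvPolynomial (Fin 3) k ⧸ J →+* B := Ideal.Quotient.lift J f hfJ
    have hF : ∀ p, F (π p) = f p := fun p => rfl
    have hFm : m.map F = (maxIdeal k 3).map f := by
      rw [hmdef, Ideal.map_map]; rfl
    have hFy : F y ∈ ((maxIdeal k 3).map f) ^ 2 := by
      rw [hyq, map_add, map_mul, hF, hF, hfl, mul_zero, zero_add, ← hFm, ← Ideal.map_pow]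
      exact Ideal.mem_map_of_mem _ hq
    apply hf1
    rw [eq_bot_iff, ← hf2]
    have h := Ideal.map_mono (f := F) hle
    rw [Ideal.map_sup, Ideal.map_mul, Ideal.map_pow, Ideal.map_pow, Ideal.map_pow, hFm,
      Ideal.map_span, Set.image_singleton] at h
    refine h.trans (sup_le ?_ le_rfl)
    refine (Ideal.mul_mono_left ((Ideal.span_singleton_le_iff_mem _).2 hFy)).trans ?_
    rw [← pow_add]
    exact Ideal.pow_le_pow_right (by omega)
  · -- H4
    have := hupm 0 0
    simpa using this
  · -- H5
    intro u hu
    obtain ⟨p, rfl⟩ := hπs u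
    obtain ⟨c, hc⟩ := sub_C_mem_maxIdeal p
    have hc' : π (p - C c) ∈ m := Ideal.mem_map_of_mem _ hc
    have hc0 : c ≠ 0 := by
      intro h
      have h1 := hu.2
      apply h1
      apply hF0q
      rw [pow_two]
      refine Ideal.mul_mem_mul ?_ (hX 2)
      simpa [h] using hc'
    have hcc : π (C c⁻¹) * π (C c) = 1 := by
      rw [← map_mul, ← C_mul, inv_mul_cancel₀ hc0]; simp
    have e : π (X 2) = π (C c⁻¹) * (π p * π (X 2)) +
        (- π (C c⁻¹)) * (π (p - C c) * π (X 2)) := by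
      rw [map_sub]
      linear_combination (- π (X 2)) * hcc
    suffices h : ∀ t, t = π (C c⁻¹) * (π p * π (X 2)) +
        (- π (C c⁻¹)) * (π (p - C c) * π (X 2)) →
        t ∈ Ideal.span {π p * π (X 2)} ⊔ m * Ideal.span {π (X 2)} from h _ e
    rintro t rfl
    exact Submodule.add_mem_sup (Ideal.mul_mem_left _ _ (Ideal.subset_span rfl))
      (Ideal.mul_mem_left _ _ (Ideal.mul_mem_mul hc' (Ideal.subset_span rfl)))

end RedConcrete

section RedExamples

theorem upI {R : Type*} [CommRing R] (m : Ideal R) (x y z a b : R) (hx : x ∈ m) (hy : y ∈ m)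
    (h1 : x ^ 2 = 0) (h2 : x * z - y ^ 2 = 0) :
    (Ideal.span {x, y}) ^ (1 + 2) ≤ Ideal.span {z - (a * x + b * y)} * m ^ (1 + 1) := by
  have hxyy : x * y ^ 2 = 0 := by linear_combination (-x) * h2 + z * h1
  have hy3 : y ^ 3 = (z - (a * x + b * y)) * (x * y) := by
    linear_combination (-y) * h2 + b * hxyy + a * y * h1
  rw [show 1 + 2 = 2 + 1 by norm_num, pow_succ, pow_two, Ideal.mul_le]
  intro p hp q hq
  have : ∀ p ∈ Ideal.span {x, y} * Ideal.span {x, y}, ∃ u v w,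
      p = u * x ^ 2 + v * (x * y) + w * y ^ 2 := by
    intro p hp
    induction hp using Submodule.mul_induction_on' with
    | mem_mul_mem p hp q hq =>
      obtain ⟨a1, b1, rfl⟩ := Ideal.mem_span_pair.1 hp
      obtain ⟨a2, b2, rfl⟩ := Ideal.mem_span_pair.1 hq
      exact ⟨a1 * a2, a1 * b2 + a2 * b1, b1 * b2, by ring⟩
    | add p _ q _ hp hq =>
      obtain ⟨u, v, w, rfl⟩ := hp
      obtain ⟨u', v', w', rfl⟩ := hq
      exact ⟨u + u', v + v', w + w', by ring⟩
  obtain ⟨u, v, w, rfl⟩ := this p hp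
  obtain ⟨a1, b1, rfl⟩ := Ideal.mem_span_pair.1 hq
  have e : (u * x ^ 2 + v * (x * y) + w * y ^ 2) * (a1 * x + b1 * y) =
      (z - (a * x + b * y)) * (w * b1 * (x * y)) := by
    linear_combination (u * (a1 * x + b1 * y) + v * y * a1) * h1 +
      (v * b1 + w * a1) * hxyy + w * b1 * hy3
  rw [e]
  refine Ideal.mul_mem_mul (Ideal.subset_span rfl) (Ideal.mul_mem_left _ _ ?_)
  rw [show 1 + 1 = 2 by norm_num, pow_two]
  exact Ideal.mul_mem_mul hx hy

theorem upG {R : Type*} [CommRing R] (x y : R)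
    (h1 : x ^ 2 = 0) (h2 : x * y = 0) (h3 : y ^ 4 = 0) :
    (Ideal.span {x, y}) ^ (2 + 2) ≤ ⊥ := by
  have hsq : Ideal.span {x, y} * Ideal.span {x, y} ≤ Ideal.span {y ^ 2} := by
    rw [Ideal.mul_le]
    intro p hp q hq
    obtain ⟨a1, b1, rfl⟩ := Ideal.mem_span_pair.1 hp
    obtain ⟨a2, b2, rfl⟩ := Ideal.mem_span_pair.1 hq
    refine Ideal.mem_span_singleton'.2 ⟨b1 * b2, ?_⟩
    linear_combination (-a1 * a2) * h1 - (a1 * b2 + a2 * b1) * h2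
  rw [show 2 + 2 = 2 * 2 by norm_num, pow_mul, pow_two (Ideal.span {x, y})]
  refine (pow_le_pow_left' hsq _).trans ?_
  rw [Ideal.span_singleton_pow, ← pow_mul, h3]
  simp

variable {k : Type*} [Field k]

theorem lowI [CharZero k] (I : Ideal (MvPolynomial (Fin 3) k))
    (hI : I = Ideal.span {X 0 ^ 2, X 0 * X 2 - X 1 ^ 2}) (a b : k)
    {B : Type*} [CommRing B] (s t : B) (ι : k →+* B) (hs : s * s = 0) (ht : t * t = 0)
    (hst : s * t ≠ 0) :
    ∃ f : MvPolynomial (Fin 3) k →+* B, (∀ p ∈ I, f p = 0) ∧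
      f (X 2 - (C a * X 0 + C b * X 1)) = 0 ∧ ((maxIdeal k 3).map f) ^ (1 + 2) = ⊥ ∧
      ((maxIdeal k 3).map f) ^ (1 + 1) ≠ ⊥ := by
  have ht2 : t ^ 2 = 0 := by rw [pow_two, ht]
  have hs2 : s ^ 2 = 0 := by rw [pow_two, hs]
  let v : Fin 3 → B :=
    ![s, t + ι (b / 2) * s, ι a * s + ι b * (t + ι (b / 2) * s)]
  let f : MvPolynomial (Fin 3) k →+* B := eval₂Hom ι v
  have f0 : f (X 0) = s := by simp [f, v]
  have f1 : f (X 1) = t + ι (b / 2) * s := by simp [f, v]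
  have f2 : f (X 2) = ι a * s + ι b * (t + ι (b / 2) * s) := by simp [f, v]
  have fC : ∀ c, f (C c) = ι c := fun c => by simp [f]
  have hι : ι b = 2 * ι (b / 2) := by
    rw [← map_ofNat ι 2, ← map_mul]; congr 1; field_simp
  have hM : (maxIdeal k 3).map f ≤ Ideal.span {s, t} := by
    rw [maxIdeal_eq3, Ideal.map_span, Ideal.span_le]
    rintro _ ⟨p, (rfl | rfl | rfl), rfl⟩
    · rw [f0]; exact Ideal.subset_span (by simp)
    · rw [f1]; exact Ideal.mem_span_pair.2 ⟨ι (b / 2), 1, by ring⟩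
    · rw [f2]; exact Ideal.mem_span_pair.2 ⟨ι a + ι b * ι (b / 2), ι b, by ring⟩
  refine ⟨f, ?_, ?_, ?_, ?_⟩
  · have : I ≤ RingHom.ker f := by
      rw [hI, Ideal.span_le]
      rintro _ (rfl | rfl)
      · simp [RingHom.mem_ker, f0, hs2]
      · simp only [SetLike.mem_coe, RingHom.mem_ker, map_sub, map_mul, map_pow, f0, f1, f2]
        rw [hι]
        linear_combination (ι a + ι (b / 2) ^ 2) * hs - ht
    exact fun p hp => this hp
  · simp only [map_sub, map_add, map_mul, fC, f0, f1, f2]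
    ring
  · rw [eq_bot_iff]
    refine (pow_le_pow_left' hM _).trans ?_
    rw [show 1 + 2 = 2 + 1 by norm_num, pow_succ, pow_two, Ideal.span_pair_mul_span_pair,
      Ideal.mul_le]
    intro p hp q hq
    rw [hs, ht, mul_comm t s] at hp
    have hp' : p ∈ Ideal.span {s * t} := by
      refine (Ideal.span_le.2 ?_) hp
      rintro _ (rfl | rfl | rfl | rfl) <;> simp [Ideal.mem_span_singleton]
    obtain ⟨c, rfl⟩ := Ideal.mem_span_singleton'.1 hp'
    obtain ⟨a1, b1, rfl⟩ := Ideal.mem_span_pair.1 hq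
    rw [Ideal.mem_bot]
    linear_combination (c * t * a1) * hs + c * s * b1 * ht
  · intro h
    apply hst
    have h0 : s ∈ (maxIdeal k 3).map f :=
      f0 ▸ Ideal.mem_map_of_mem f (Ideal.subset_span ⟨0, rfl⟩)
    have h1 : t + ι (b / 2) * s ∈ (maxIdeal k 3).map f :=
      f1 ▸ Ideal.mem_map_of_mem f (Ideal.subset_span ⟨1, rfl⟩)
    have h2 := Ideal.mul_mem_mul h0 h1
    rw [← pow_two] at h2
    replace h2 : s * (t + ι (b / 2) * s) ∈ (⊥ : Ideal B) := h ▸ h2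
    rw [Ideal.mem_bot] at h2
    linear_combination h2 - ι (b / 2) * hs

theorem lowG (G : Ideal (MvPolynomial (Fin 3) k))
    (hG : G = Ideal.span {X 0 ^ 2, X 0 * X 1, X 0 * X 2 ^ 2, X 1 ^ 4}) (a b : k)
    {B : Type*} [CommRing B] (t : B) (ι : k →+* B) (ht : t ^ 4 = 0) (ht3 : t ^ 3 ≠ 0) :
    ∃ f : MvPolynomial (Fin 3) k →+* B, (∀ p ∈ G, f p = 0) ∧
      f (X 2 - (C a * X 0 + C b * X 1)) = 0 ∧ ((maxIdeal k 3).map f) ^ (2 + 2) = ⊥ ∧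
      ((maxIdeal k 3).map f) ^ (2 + 1) ≠ ⊥ := by
  let f : MvPolynomial (Fin 3) k →+* B := eval₂Hom ι ![0, t, ι b * t]
  have e0 : f (X 0) = 0 := by simp [f]
  have e1 : f (X 1) = t := by simp [f]
  have e2 : f (X 2) = ι b * t := by simp [f]
  have eC : ∀ c, f (C c) = ι c := fun c => by simp [f]
  refine ⟨f, ?_, ?_, ?_, ?_⟩
  · have : G ≤ RingHom.ker f := by
      rw [hG, Ideal.span_le]
      rintro _ (rfl | rfl | rfl | rfl) <;> simp [RingHom.mem_ker, e0, e1, ht]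
    exact fun p hp => this hp
  · simp only [map_sub, map_add, map_mul, eC, e0, e1, e2]
    ring
  · have hM : (maxIdeal k 3).map f ≤ Ideal.span {t} := by
      rw [maxIdeal_eq3, Ideal.map_span, Ideal.span_le]
      rintro _ ⟨p, (rfl | rfl | rfl), rfl⟩
      · rw [e0]; exact Ideal.zero_mem _
      · rw [e1]; exact Ideal.subset_span rfl
      · rw [e2]; exact Ideal.mul_mem_left _ _ (Ideal.subset_span rfl)
    rw [eq_bot_iff]
    refine (pow_le_pow_left' hM _).trans ?_
    rw [Ideal.span_singleton_pow, ht]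
    simp
  · intro h
    apply ht3
    have h1 : t ∈ (maxIdeal k 3).map f :=
      e1 ▸ Ideal.mem_map_of_mem f (Ideal.subset_span ⟨1, rfl⟩)
    have h2 : t ^ (2 + 1) ∈ ((maxIdeal k 3).map f) ^ (2 + 1) := Ideal.pow_mem_pow h1 _
    rw [h, Ideal.mem_bot] at h2
    exact h2

theorem redNum_I [CharZero k] (I : Ideal (MvPolynomial (Fin 3) k))
    (hI : I = Ideal.span {X 0 ^ 2, X 0 * X 2 - X 1 ^ 2}) :
    ringRedNum (maxIdealQ I) = 2 := by
  refine ringRedNum_concrete I 1 ?_ ?_ ?_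
  · have : I ≤ RingHom.ker (lineHom k) := by
      rw [hI, Ideal.span_le]
      rintro _ (rfl | rfl)
      · simp [RingHom.mem_ker, lineHom_X0]
      · simp [RingHom.mem_ker, lineHom_X0, lineHom_X1]
    exact fun p hp => this hp
  · intro a b
    have hX : ∀ i, Ideal.Quotient.mk I (X i) ∈ maxIdealQ I := fun i =>
      Ideal.mem_map_of_mem _ (Ideal.subset_span ⟨i, rfl⟩)
    have h1 : Ideal.Quotient.mk I (X 0 ^ 2) = 0 :=
      Ideal.Quotient.eq_zero_iff_mem.2 (hI ▸ Ideal.subset_span (by simp))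
    have h2 : Ideal.Quotient.mk I (X 0 * X 2 - X 1 ^ 2) = 0 :=
      Ideal.Quotient.eq_zero_iff_mem.2 (hI ▸ Ideal.subset_span (by simp))
    rw [map_pow] at h1
    rw [map_sub, map_mul, map_pow] at h2
    rw [map_sub, map_add, map_mul, map_mul]
    exact upI _ _ _ _ _ _ (hX 0) (hX 1) h1 h2
  · intro a b
    let s : DualNumber (DualNumber k) := TrivSqZeroExt.inl DualNumber.eps
    let t : DualNumber (DualNumber k) := DualNumber.eps
    have hs : s * s = 0 := by
      simp only [s]
      rw [← TrivSqZeroExt.inl_mul, DualNumber.eps_mul_eps, TrivSqZeroExt.inl_zero]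
    have ht : t * t = 0 := DualNumber.eps_mul_eps
    have hst : s * t ≠ 0 := by
      intro h
      have := congrArg (fun x => TrivSqZeroExt.snd (TrivSqZeroExt.snd x)) h
      simp [s, t] at this
    exact ⟨_, inferInstance, lowI I hI a b s t (algebraMap k _) hs ht hst⟩

theorem redNum_G (G : Ideal (MvPolynomial (Fin 3) k))
    (hG : G = Ideal.span {X 0 ^ 2, X 0 * X 1, X 0 * X 2 ^ 2, X 1 ^ 4}) :
    ringRedNum (maxIdealQ G) = 3 := by
  refine ringRedNum_concrete G 2 ?_ ?_ ?_
  · have : G ≤ RingHom.ker (lineHom k) := by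
      rw [hG, Ideal.span_le]
      rintro _ (rfl | rfl | rfl | rfl) <;> simp [RingHom.mem_ker, lineHom_X0, lineHom_X1]
    exact fun p hp => this hp
  · intro a b
    have h1 : Ideal.Quotient.mk G (X 0 ^ 2) = 0 :=
      Ideal.Quotient.eq_zero_iff_mem.2 (hG ▸ Ideal.subset_span (by simp))
    have h2 : Ideal.Quotient.mk G (X 0 * X 1) = 0 :=
      Ideal.Quotient.eq_zero_iff_mem.2 (hG ▸ Ideal.subset_span (by simp))
    have h3 : Ideal.Quotient.mk G (X 1 ^ 4) = 0 :=
      Ideal.Quotient.eq_zero_iff_mem.2 (hG ▸ Ideal.subset_span (by simp))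
    rw [map_pow] at h1 h3
    rw [map_mul] at h2
    exact le_trans (upG _ _ h1 h2 h3) bot_le
  · intro a b
    let q := Ideal.Quotient.mk (Ideal.span {(Polynomial.X ^ 4 : Polynomial k)})
    have hq4 : q Polynomial.X ^ 4 = 0 := by
      rw [← map_pow]; exact Ideal.Quotient.eq_zero_iff_mem.2 (Ideal.subset_span rfl)
    have hq3 : q Polynomial.X ^ 3 ≠ 0 := by
      intro h2
      rw [← map_pow] at h2
      have h3 := Ideal.Quotient.eq_zero_iff_mem.1 h2
      rw [Ideal.mem_span_singleton, Polynomial.X_pow_dvd_iff] at h3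
      have := h3 3 (by norm_num)
      simp at this
    exact ⟨_, inferInstance, lowG G hG a b _ (q.comp Polynomial.C) hq4 hq3⟩

end RedExamples

section GinBasics

/-- The quadratic polynomial attached to column `i` of `h`. -/
def pp {A : Type*} [CommRing A] (h : Matrix (Fin 3) (Fin 3) A) (i : Fin 3) : Polynomial A :=
  Polynomial.C (h 2 i) + Polynomial.C (h 1 i) * Polynomial.X +
    Polynomial.C (h 0 i) * Polynomial.X ^ 2

def w2 {A : Type*} [CommRing A] (h : Matrix (Fin 3) (Fin 3) A) : Fin 4 → Polynomial A :=
  ![pp h 0 * pp h 2, pp h 1 ^ 2, pp h 1 * pp h 2, pp h 2 ^ 2]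

def w3 {A : Type*} [CommRing A] (h : Matrix (Fin 3) (Fin 3) A) : Fin 4 → Polynomial A :=
  fun i => pp h 1 ^ (i : ℕ) * pp h 2 ^ (3 - (i : ℕ))

def cmat {A : Type*} [CommRing A] (w : Fin 4 → Polynomial A) : Matrix (Fin 4) (Fin 4) A :=
  Matrix.of fun i j => (w i).coeff (j : ℕ)

def disc {A : Type*} [CommRing A] (h : Matrix (Fin 3) (Fin 3) A) : A :=
  h 2 2 * (cmat (w2 h)).det * (cmat (w3 h)).det

theorem pp_map {A B : Type*} [CommRing A] [CommRing B] (f : A →+* B)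
    (h : Matrix (Fin 3) (Fin 3) A) (i : Fin 3) :
    pp (f.mapMatrix h) i = (pp h i).map f := by
  simp [pp]

theorem cmat_map {A B : Type*} [CommRing A] [CommRing B] (f : A →+* B)
    (w : Fin 4 → Polynomial A) :
    cmat (fun i => (w i).map f) = f.mapMatrix (cmat w) := by
  ext i j; simp [cmat]

theorem disc_map {A B : Type*} [CommRing A] [CommRing B] (f : A →+* B)
    (h : Matrix (Fin 3) (Fin 3) A) : disc (f.mapMatrix h) = f (disc h) := by
  have h2 : w2 (f.mapMatrix h) = fun i => (w2 h i).map f := by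
    funext i
    fin_cases i <;> simp [w2, pp_map, -RingHom.mapMatrix_apply]
  have h3 : w3 (f.mapMatrix h) = fun i => (w3 h i).map f := by
    funext i
    simp [w3, pp_map, -RingHom.mapMatrix_apply]
  rw [disc, disc, h2, h3, cmat_map, cmat_map, map_mul, map_mul, RingHom.map_det, RingHom.map_det]
  simp

variable {k : Type*} [Field k]

/-- Exponent vector. -/
def ex (a b c : ℕ) : Fin 3 →₀ ℕ := Finsupp.equivFunOnFinite.symm ![a, b, c]

@[simp] theorem ex_0 (a b c : ℕ) : ex a b c 0 = a := rfl
@[simp] theorem ex_1 (a b c : ℕ) : ex a b c 1 = b := rfl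
@[simp] theorem ex_2 (a b c : ℕ) : ex a b c 2 = c := rfl

theorem ex_ext {e f : Fin 3 →₀ ℕ} (h0 : e 0 = f 0) (h1 : e 1 = f 1) (h2 : e 2 = f 2) : e = f := by
  ext i; fin_cases i <;> assumption

theorem deg3 (e : Fin 3 →₀ ℕ) : e.degree = e 0 + e 1 + e 2 := by
  rw [Finsupp.degree_eq_sum, Fin.sum_univ_three]

theorem mon_eq (e : Fin 3 →₀ ℕ) :
    monomial e (1 : k) = X 0 ^ e 0 * X 1 ^ e 1 * X 2 ^ e 2 := by
  rw [monomial_eq, Finsupp.prod_fintype _ _ (by simp), Fin.prod_univ_three]; simp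

theorem lexlt3 (e f : Fin 3 →₀ ℕ) : lexlt e f ↔ e 0 < f 0 ∨ (e 0 = f 0 ∧ e 1 < f 1) ∨
    (e 0 = f 0 ∧ e 1 = f 1 ∧ e 2 < f 2) := by
  constructor
  · rintro ⟨i, hi, hj⟩
    fin_cases i
    · exact Or.inl hi
    · exact Or.inr (Or.inl ⟨hj 0 (by decide), hi⟩)
    · exact Or.inr (Or.inr ⟨hj 0 (by decide), hj 1 (by decide), hi⟩)
  · rintro (h | ⟨h0, h⟩ | ⟨h0, h1, h⟩)
    · exact ⟨0, h, fun j hj => absurd hj (by simp)⟩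
    · refine ⟨1, h, fun j hj => ?_⟩
      fin_cases j
      · exact h0
      · exact absurd hj (by decide)
      · exact absurd hj (by decide)
    · refine ⟨2, h, fun j hj => ?_⟩
      fin_cases j
      · exact h0
      · exact h1
      · exact absurd hj (by decide)

/-- Independence modulo `X^4`. -/
def Hind (w : Fin 4 → Polynomial k) : Prop :=
  ∀ c : Fin 4 → k, Polynomial.X ^ 4 ∣ ∑ i, Polynomial.C (c i) * w i → c = 0

theorem coeff_comb (w : Fin 4 → Polynomial k) (c : Fin 4 → k) (j : Fin 4) :
    (∑ i, Polynomial.C (c i) * w i).coeff (j : ℕ) = Matrix.vecMul c (cmat w) j := by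
  simp [Polynomial.finsetSum_coeff, Matrix.vecMul, dotProduct, cmat]

theorem hind_of_det (w : Fin 4 → Polynomial k) (hw : (cmat w).det ≠ 0) : Hind w := by
  intro c hc
  rw [Polynomial.X_pow_dvd_iff] at hc
  refine Matrix.eq_zero_of_vecMul_eq_zero hw ?_
  ext j
  rw [← coeff_comb]
  exact hc j j.2

theorem hind_surj (w : Fin 4 → Polynomial k) (hw : Hind w) (q : Polynomial k) :
    ∃ c : Fin 4 → k, Polynomial.X ^ 4 ∣ q - ∑ i, Polynomial.C (c i) * w i := by
  have hinj : Function.Injective (Matrix.vecMulLinear (cmat w)) := by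
    rw [injective_iff_map_eq_zero]
    intro c hc
    apply hw
    rw [Polynomial.X_pow_dvd_iff]
    intro d hd
    have := congrFun hc ⟨d, hd⟩
    exact (coeff_comb w c ⟨d, hd⟩).trans this
  obtain ⟨c, hc⟩ := LinearMap.injective_iff_surjective.1 hinj (fun j => q.coeff (j : ℕ))
  refine ⟨c, ?_⟩
  rw [Polynomial.X_pow_dvd_iff]
  intro d hd
  have := congrFun hc ⟨d, hd⟩
  rw [Polynomial.coeff_sub, sub_eq_zero]
  rw [coeff_comb w c ⟨d, hd⟩]
  exact this.symm

theorem hind_mul (w : Fin 4 → Polynomial k) (hw : Hind w) (p : Polynomial k)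
    (hp : p.coeff 0 ≠ 0) (n : ℕ) : Hind (fun i => w i * p ^ n) := by
  intro c hc
  apply hw
  have e : ∑ i, Polynomial.C (c i) * (w i * p ^ n) = (∑ i, Polynomial.C (c i) * w i) * p ^ n := by
    rw [Finset.sum_mul]; exact Finset.sum_congr rfl fun i _ => by ring
  rw [e] at hc
  refine IsCoprime.dvd_of_dvd_mul_right ?_ hc
  refine IsCoprime.pow ?_
  rw [(Polynomial.irreducible_X).coprime_iff_not_dvd, Polynomial.X_dvd_iff]
  exact hp

/-- Substitution of the quadratics. -/
def psi (h : Matrix (Fin 3) (Fin 3) k) : MvPolynomial (Fin 3) k →ₐ[k] Polynomial k :=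
  aeval (pp h)

theorem psi_mon (h : Matrix (Fin 3) (Fin 3) k) (e : Fin 3 →₀ ℕ) :
    psi h (monomial e 1) = pp h 0 ^ e 0 * pp h 1 ^ e 1 * pp h 2 ^ e 2 := by
  rw [mon_eq]; simp [psi]

/-- Exponents of the degree two family. -/
def b2 : Fin 4 → (Fin 3 →₀ ℕ) := ![ex 1 0 1, ex 0 2 0, ex 0 1 1, ex 0 0 2]

/-- Exponents of the degree `n+3` family. -/
def b3 (n : ℕ) : Fin 4 → (Fin 3 →₀ ℕ) := fun i => ex 0 i (3 - i + n)

theorem hind_b2 (h : Matrix (Fin 3) (Fin 3) k) (hd : disc h ≠ 0) :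
    Hind (fun i => psi h (monomial (b2 i) 1)) := by
  have : (fun i => psi h (monomial (b2 i) 1)) = w2 h := by
    funext i
    rw [psi_mon]
    fin_cases i <;> simp [b2, w2]
  rw [this]
  refine hind_of_det _ fun h0 => hd ?_
  simp [disc, h0]

theorem hind_b3 (h : Matrix (Fin 3) (Fin 3) k) (hd : disc h ≠ 0) (n : ℕ) :
    Hind (fun i => psi h (monomial (b3 n i) 1)) := by
  have : (fun i => psi h (monomial (b3 n i) 1)) = fun i => w3 h i * pp h 2 ^ n := by
    funext i
    rw [psi_mon]
    simp [b3, w3, pow_add, mul_assoc]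
  rw [this]
  refine hind_mul _ (hind_of_det _ fun h0 => hd ?_) _ ?_ _
  · simp [disc, h0]
  · intro h0
    apply hd
    have : h 2 2 = 0 := by simpa [pp] using h0
    simp [disc, this]

theorem b2_inj : Function.Injective b2 := by
  intro i j hij
  have h0 := DFunLike.congr_fun hij 0
  have h1 := DFunLike.congr_fun hij 1
  fin_cases i <;> fin_cases j <;> simp [b2] at h0 h1 ⊢

theorem b3_inj (n : ℕ) : Function.Injective (b3 n) := by
  intro i j hij
  have h1 := DFunLike.congr_fun hij 1
  exact Fin.ext h1

theorem deg_b2 (i : Fin 4) : (b2 i).degree = 2 := by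
  rw [deg3]; fin_cases i <;> simp [b2]

theorem deg_b3 (n : ℕ) (i : Fin 4) : (b3 n i).degree = n + 3 := by
  rw [deg3]; have := i.2; simp only [b3, ex_0, ex_1, ex_2]; omega

end GinBasics

section GinMain

variable {k : Type*} [Field k]

theorem psi_act (g : Matrix (Fin 3) (Fin 3) k) (F : MvPolynomial (Fin 3) k) :
    psi g.adjugate (act g F) =
      aeval ![Polynomial.C g.det * Polynomial.X ^ 2, Polynomial.C g.det * Polynomial.X,
        Polynomial.C g.det] F := by
  have key : ∀ m j, ∑ i, g.adjugate m i * g i j = if m = j then g.det else 0 := by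
    intro m j
    have := congrFun (congrFun (Matrix.adjugate_mul g) m) j
    rw [Matrix.mul_apply] at this
    rw [this, Matrix.smul_apply, Matrix.one_apply]
    simp
  suffices h : (psi g.adjugate).comp (act g) =
      aeval ![Polynomial.C g.det * Polynomial.X ^ 2, Polynomial.C g.det * Polynomial.X,
        Polynomial.C g.det] from DFunLike.congr_fun h F
  apply MvPolynomial.algHom_ext
  intro j
  have e : ((psi g.adjugate).comp (act g)) (X j) =
      Polynomial.C (∑ i, g.adjugate 2 i * g i j) +
      Polynomial.C (∑ i, g.adjugate 1 i * g i j) * Polynomial.X +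
      Polynomial.C (∑ i, g.adjugate 0 i * g i j) * Polynomial.X ^ 2 := by
    simp only [AlgHom.comp_apply, act, aeval_X, psi, map_add, map_mul, algHom_C, pp,
      Fin.sum_univ_three, Polynomial.algebraMap_eq]
    ring
  rw [e, key, key, key, aeval_X]
  fin_cases j <;> simp

theorem act_hom (g : Matrix (Fin 3) (Fin 3) k) (F : MvPolynomial (Fin 3) k) (d : ℕ)
    (hF : F.IsHomogeneous d) : (act g F).IsHomogeneous d := by
  have := hF.aeval (fun j => ∑ i, C (g i j) * X i : Fin 3 → MvPolynomial (Fin 3) k) (n := 1)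
    (fun j => IsHomogeneous.sum _ _ _ fun i _ => by
      simpa using (isHomogeneous_C (Fin 3) (g i j)).mul (isHomogeneous_X k i))
  rw [one_mul] at this
  exact this

theorem act_inv (g : Matrix (Fin 3) (Fin 3) k) (hg : IsUnit g.det)
    (F : MvPolynomial (Fin 3) k) : act g (act g⁻¹ F) = F := by
  have key : ∀ l j, ∑ i, g l i * g⁻¹ i j = if l = j then 1 else 0 := by
    intro m j
    have := congrFun (congrFun (Matrix.mul_nonsing_inv g hg) m) j
    rw [Matrix.mul_apply] at this
    rw [this, Matrix.one_apply]
  suffices h : (act g).comp (act g⁻¹) = AlgHom.id k _ from DFunLike.congr_fun h F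
  apply MvPolynomial.algHom_ext
  intro j
  have e : ((act g).comp (act g⁻¹)) (X j) =
      ∑ l, C (∑ i, g l i * g⁻¹ i j) * X l := by
    simp only [AlgHom.comp_apply, act, aeval_X, map_add, map_mul, algHom_C,
      Fin.sum_univ_three, MvPolynomial.algebraMap_eq]
    ring
  rw [e]
  simp only [key, AlgHom.id_apply, Fin.sum_univ_three]
  fin_cases j <;> simp

theorem mon_mem (J : Ideal (MvPolynomial (Fin 3) k)) (s e : Fin 3 →₀ ℕ) (h0 : s 0 ≤ e 0)
    (h1 : s 1 ≤ e 1) (h2 : s 2 ≤ e 2) (hs : monomial s (1 : k) ∈ J) :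
    monomial e (1 : k) ∈ J := by
  have : monomial e (1 : k) = monomial (ex (e 0 - s 0) (e 1 - s 1) (e 2 - s 2)) 1 *
      monomial s 1 := by
    rw [monomial_mul, mul_one]
    congr 2
    apply ex_ext <;> simp <;> omega
  rw [this]
  exact Ideal.mul_mem_left _ _ hs

/-- Standard monomials modulo `I` in degree `m+2`. -/
def stdm (m : ℕ) : Fin 4 → (Fin 3 →₀ ℕ) := ![ex 0 0 (m + 2), ex 0 1 (m + 1), ex 1 0 (m + 1), ex 1 1 m]

theorem mod_I (I : Ideal (MvPolynomial (Fin 3) k))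
    (hI : I = Ideal.span {X 0 ^ 2, X 0 * X 2 - X 1 ^ 2}) (m : ℕ)
    (F : MvPolynomial (Fin 3) k) (hF : F.IsHomogeneous (m + 2)) :
    ∃ c : Fin 4 → k, F - ∑ i, c i • monomial (stdm m i) (1 : k) ∈ I := by
  have g1 : (X 0 ^ 2 : MvPolynomial (Fin 3) k) ∈ I := hI ▸ Ideal.subset_span (by simp)
  have g2 : (X 0 * X 2 - X 1 ^ 2 : MvPolynomial (Fin 3) k) ∈ I :=
    hI ▸ Ideal.subset_span (by simp)
  let W : Submodule k (MvPolynomial (Fin 3) k) := I.restrictScalars k ⊔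
    Submodule.span k (Set.range fun i => monomial (stdm m i) (1 : k))
  have hstd : ∀ i, monomial (stdm m i) (1 : k) ∈ W := fun i =>
    Submodule.mem_sup_right (Submodule.subset_span ⟨i, rfl⟩)
  have hIW : ∀ p ∈ I, p ∈ W := fun p hp => Submodule.mem_sup_left hp
  have hsub : ∀ p q, p - q ∈ I → q ∈ W → p ∈ W := by
    intro p q h1 h2
    have := W.add_mem (hIW _ h1) h2
    simpa using this
  have hmon : ∀ e : Fin 3 →₀ ℕ, e 0 + e 1 + e 2 = m + 2 → monomial e (1 : k) ∈ W := by
    intro e he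
    have s0 := hstd 0
    have s1 := hstd 1
    have s2 := hstd 2
    have s3 := hstd 3
    rw [mon_eq] at s0 s1 s2 s3 ⊢
    simp only [stdm, Matrix.cons_val, ex_0, ex_1, ex_2] at s0 s1 s2 s3
    generalize e 0 = a at *
    generalize e 1 = b at *
    generalize e 2 = c at *
    rcases Nat.lt_or_ge a 2 with ha | ha
    swap
    · obtain ⟨a', rfl⟩ := Nat.exists_eq_add_of_le ha
      apply hIW
      rw [show (X 0 ^ (2 + a') * X 1 ^ b * X 2 ^ c : MvPolynomial (Fin 3) k) =
        (X 0 ^ a' * X 1 ^ b * X 2 ^ c) * X 0 ^ 2 by ring]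
      exact I.mul_mem_left _ g1
    have hxyy : (X 0 * X 1 ^ 2 : MvPolynomial (Fin 3) k) ∈ I := by
      rw [show (X 0 * X 1 ^ 2 : MvPolynomial (Fin 3) k) =
        X 2 * X 0 ^ 2 - X 0 * (X 0 * X 2 - X 1 ^ 2) by ring]
      exact I.sub_mem (I.mul_mem_left _ g1) (I.mul_mem_left _ g2)
    have hy4 : (X 1 ^ 4 : MvPolynomial (Fin 3) k) ∈ I := by
      rw [show (X 1 ^ 4 : MvPolynomial (Fin 3) k) =
        X 2 * (X 0 * X 1 ^ 2) - X 1 ^ 2 * (X 0 * X 2 - X 1 ^ 2) by ring]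
      exact I.sub_mem (I.mul_mem_left _ hxyy) (I.mul_mem_left _ g2)
    interval_cases a
    · rcases Nat.lt_or_ge b 4 with hb | hb
      swap
      · obtain ⟨b', rfl⟩ := Nat.exists_eq_add_of_le hb
        apply hIW
        rw [show (X 0 ^ 0 * X 1 ^ (4 + b') * X 2 ^ c : MvPolynomial (Fin 3) k) =
          (X 1 ^ b' * X 2 ^ c) * X 1 ^ 4 by ring]
        exact I.mul_mem_left _ hy4
      interval_cases b
      · obtain rfl : c = m + 2 := by omega
        exact s0
      · obtain rfl : c = m + 1 := by omega
        exact s1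
      · obtain rfl : c = m := by omega
        refine hsub _ _ ?_ s2
        rw [show (X 0 ^ 0 * X 1 ^ 2 * X 2 ^ c - X 0 ^ 1 * X 1 ^ 0 * X 2 ^ (c + 1) :
          MvPolynomial (Fin 3) k) = (- X 2 ^ c) * (X 0 * X 2 - X 1 ^ 2) by ring]
        exact I.mul_mem_left _ g2
      · obtain rfl : m = c + 1 := by omega
        refine hsub _ _ ?_ s3
        rw [show (X 0 ^ 0 * X 1 ^ 3 * X 2 ^ c - X 0 ^ 1 * X 1 ^ 1 * X 2 ^ (c + 1) :
          MvPolynomial (Fin 3) k) = (- (X 1 * X 2 ^ c)) * (X 0 * X 2 - X 1 ^ 2) by ring]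
        exact I.mul_mem_left _ g2
    · rcases Nat.lt_or_ge b 2 with hb | hb
      swap
      · obtain ⟨b', rfl⟩ := Nat.exists_eq_add_of_le hb
        apply hIW
        rw [show (X 0 ^ 1 * X 1 ^ (2 + b') * X 2 ^ c : MvPolynomial (Fin 3) k) =
          (X 1 ^ b' * X 2 ^ c) * (X 0 * X 1 ^ 2) by ring]
        exact I.mul_mem_left _ hxyy
      interval_cases b
      · obtain rfl : c = m + 1 := by omega
        exact s2
      · obtain rfl : c = m := by omega
        exact s3
  have hFW : F ∈ W := by
    rw [F.as_sum]
    refine Submodule.sum_mem _ fun e he => ?_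
    have hdeg : e.degree = m + 2 := by
      by_contra hne
      exact (mem_support_iff.1 he) (hF.coeff_eq_zero hne)
    rw [deg3] at hdeg
    have : monomial e (coeff e F) = coeff e F • monomial e (1 : k) := by
      rw [smul_monomial, smul_eq_mul, mul_one]
    rw [this]
    exact W.smul_mem _ (hmon e hdeg)
  obtain ⟨p, hp, q, hq, hpq⟩ := Submodule.mem_sup.1 hFW
  obtain ⟨c, hc⟩ := (Submodule.mem_span_range_iff_exists_fun k).1 hq
  refine ⟨c, ?_⟩
  rw [hc, ← hpq, add_sub_cancel_right]
  exact hp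

theorem dvd_of_mem (I : Ideal (MvPolynomial (Fin 3) k))
    (hI : I = Ideal.span {X 0 ^ 2, X 0 * X 2 - X 1 ^ 2}) (g : Matrix (Fin 3) (Fin 3) k)
    (f : MvPolynomial (Fin 3) k) (hf : f ∈ actI g I) :
    Polynomial.X ^ 4 ∣ psi g.adjugate f := by
  have : actI g I ≤ (Ideal.span {(Polynomial.X ^ 4 : Polynomial k)}).comap
      (psi g.adjugate).toRingHom := by
    rw [actI, hI, Ideal.map_span, Ideal.span_le]
    rintro _ ⟨p, (rfl | rfl), rfl⟩
    · rw [SetLike.mem_coe, Ideal.mem_comap]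
      change psi g.adjugate (act g _) ∈ _
      rw [psi_act, Ideal.mem_span_singleton]
      refine ⟨Polynomial.C g.det ^ 2, ?_⟩
      simp
      ring
    · rw [SetLike.mem_coe, Ideal.mem_comap]
      change psi g.adjugate (act g _) ∈ _
      rw [psi_act, Ideal.mem_span_singleton]
      refine ⟨0, ?_⟩
      simp
      ring
  exact Ideal.mem_span_singleton.1 (this hf)

theorem mem_of_dvd (I : Ideal (MvPolynomial (Fin 3) k))
    (hI : I = Ideal.span {X 0 ^ 2, X 0 * X 2 - X 1 ^ 2}) (g : Matrix (Fin 3) (Fin 3) k)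
    (hg : IsUnit g.det) (m : ℕ)
    (F : MvPolynomial (Fin 3) k) (hF : F.IsHomogeneous (m + 2))
    (hd : Polynomial.X ^ 4 ∣ psi g.adjugate F) : F ∈ actI g I := by
  obtain ⟨c, hc⟩ := mod_I I hI m (act g⁻¹ F) (act_hom _ _ _ hF)
  have h1 := dvd_of_mem I hI g _ (Ideal.mem_map_of_mem (act g) hc)
  rw [map_sub, act_inv g hg, map_sub, dvd_sub_right hd, psi_act] at h1
  have e : aeval ![Polynomial.C g.det * Polynomial.X ^ 2, Polynomial.C g.det * Polynomial.X,
        Polynomial.C g.det] (∑ i, c i • monomial (stdm m i) (1 : k)) =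
      Polynomial.C (g.det ^ (m + 2)) * (Polynomial.C (c 0) + Polynomial.C (c 1) * Polynomial.X +
        Polynomial.C (c 2) * Polynomial.X ^ 2 + Polynomial.C (c 3) * Polynomial.X ^ 3) := by
    simp only [Fin.sum_univ_four, mon_eq, map_add, map_smul, map_mul, map_pow, aeval_X, stdm,
      Matrix.cons_val, ex_0, ex_1, ex_2, Polynomial.smul_eq_C_mul]
    ring
  rw [e] at h1
  have hne : g.det ^ (m + 2) ≠ 0 := pow_ne_zero _ hg.ne_zero
  have hu : IsUnit (Polynomial.C (g.det ^ (m + 2))) := Polynomial.isUnit_C.2 (hne.isUnit)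
  rw [hu.dvd_mul_left, Polynomial.X_pow_dvd_iff] at h1
  have c0 := h1 0 (by norm_num)
  have c1 := h1 1 (by norm_num)
  have c2 := h1 2 (by norm_num)
  have c3 := h1 3 (by norm_num)
  simp [Polynomial.coeff_X, Polynomial.coeff_C, Polynomial.coeff_X_pow] at c0 c1 c2 c3
  have hc0 : (∑ i, c i • monomial (stdm m i) (1 : k)) = 0 := by
    simp [Fin.sum_univ_four, c0, c1, c2, c3]
  rw [hc0, sub_zero] at hc
  have := Ideal.mem_map_of_mem (act g) hc
  rwa [act_inv g hg] at this

end GinMain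

section GinFinal

variable {k : Type*} [Field k]

theorem gen_mem (I : Ideal (MvPolynomial (Fin 3) k))
    (hI : I = Ideal.span {X 0 ^ 2, X 0 * X 2 - X 1 ^ 2}) (g : Matrix (Fin 3) (Fin 3) k)
    (hg : IsUnit g.det) (m : ℕ) (b : Fin 4 → (Fin 3 →₀ ℕ))
    (hb : Hind (fun i => psi g.adjugate (monomial (b i) 1)))
    (hdeg : ∀ i, (b i).degree = m + 2) (a : Fin 3 →₀ ℕ) (ha : a.degree = m + 2)
    (hlt : ∀ i, lexlt (b i) a) :
    monomial a (1 : k) ∈ inIdealW lexlt (actI g I) := by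
  obtain ⟨c, hc⟩ := hind_surj _ hb (psi g.adjugate (monomial a 1))
  have hirr : ∀ i, b i ≠ a := by
    intro i h
    have := hlt i
    rw [h, lexlt3] at this
    omega
  have hco : ∀ e, coeff e (monomial a (1 : k) - ∑ i, c i • monomial (b i) (1 : k)) =
      (if a = e then 1 else 0) - ∑ i, c i * (if b i = e then 1 else 0) := by
    intro e
    rw [coeff_sub, coeff_sum, coeff_monomial]
    simp only [coeff_smul, coeff_monomial, smul_eq_mul]
  refine Ideal.subset_span ⟨monomial a (1 : k) - ∑ i, c i • monomial (b i) (1 : k), a,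
    ?_, ⟨?_, ?_⟩, rfl⟩
  · refine mem_of_dvd I hI g hg m _ ?_ ?_
    · refine (isHomogeneous_monomial _ ha).sub (IsHomogeneous.sum _ _ _ fun i _ => ?_)
      rw [smul_monomial]
      exact isHomogeneous_monomial _ (hdeg i)
    · rw [map_sub, map_sum]
      simpa [Polynomial.smul_eq_C_mul] using hc
  · rw [mem_support_iff, hco]
    simp [hirr]
  · intro e he hea
    rw [mem_support_iff, hco, if_neg (Ne.symm hea), zero_sub, neg_ne_zero] at he
    obtain ⟨i, -, hi⟩ := Finset.exists_ne_zero_of_sum_ne_zero he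
    have : b i = e := by
      by_contra hne
      simp [hne] at hi
    rw [← this]
    exact hlt i

theorem low_zero (I : Ideal (MvPolynomial (Fin 3) k))
    (hI : I = Ideal.span {X 0 ^ 2, X 0 * X 2 - X 1 ^ 2}) (g : Matrix (Fin 3) (Fin 3) k)
    (b : Fin 4 → (Fin 3 →₀ ℕ)) (hinj : Function.Injective b)
    (hb : Hind (fun i => psi g.adjugate (monomial (b i) 1)))
    (F : MvPolynomial (Fin 3) k) (hF : F ∈ actI g I)
    (hs : ∀ e, coeff e F ≠ 0 → ∃ i, b i = e) : F = 0 := by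
  have hFe : F = ∑ i, coeff (b i) F • monomial (b i) (1 : k) := by
    ext e
    rw [coeff_sum]
    simp only [coeff_smul, coeff_monomial, smul_eq_mul, mul_ite, mul_one, mul_zero]
    by_cases he : ∃ i, b i = e
    · obtain ⟨i, rfl⟩ := he
      rw [Finset.sum_eq_single i]
      · simp
      · intro j _ hj
        rw [if_neg fun h => hj (hinj h)]
      · simp
    · rw [Finset.sum_eq_zero]
      · by_contra h
        exact he (hs e h)
      · intro i _
        rw [if_neg fun h => he ⟨i, h⟩]
  have hd := dvd_of_mem I hI g F hF
  have hc : (fun i => coeff (b i) F) = 0 := by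
    apply hb
    rw [hFe, map_sum] at hd
    simpa only [map_smul, Polynomial.smul_eq_C_mul] using hd
  rw [hFe]
  refine Finset.sum_eq_zero fun i _ => ?_
  rw [show coeff (b i) F = 0 from congrFun hc i, zero_smul]

theorem actI_homog_s17 (I : Ideal (MvPolynomial (Fin 3) k))
    (hI : I = Ideal.span {X 0 ^ 2, X 0 * X 2 - X 1 ^ 2}) (g : Matrix (Fin 3) (Fin 3) k)
    (f : MvPolynomial (Fin 3) k) (hf : f ∈ actI g I) (d : ℕ) :
    homogeneousComponent d f ∈ actI g I := by
  let _ : GradedAlgebra (homogeneousSubmodule (Fin 3) k) := MvPolynomial.gradedAlgebra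
  refine homogeneousComponent_mem_of_mem ?_ hf d
  rw [actI, hI, Ideal.map_span]
  apply Ideal.homogeneous_span
  rintro _ ⟨p, hp, rfl⟩
  refine ⟨2, ?_⟩
  rw [mem_homogeneousSubmodule]
  apply act_hom
  rcases hp with rfl | rfl
  · exact (isHomogeneous_X k 0).pow 2
  · exact ((isHomogeneous_X k 0).mul (isHomogeneous_X k 2)).sub ((isHomogeneous_X k 1).pow 2)

theorem in_eq (I G : Ideal (MvPolynomial (Fin 3) k))
    (hI : I = Ideal.span {X 0 ^ 2, X 0 * X 2 - X 1 ^ 2})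
    (hG : G = Ideal.span {X 0 ^ 2, X 0 * X 1, X 0 * X 2 ^ 2, X 1 ^ 4})
    (g : Matrix (Fin 3) (Fin 3) k) (hg : IsUnit g.det) (hd : disc g.adjugate ≠ 0) :
    inIdealW lexlt (actI g I) = G := by
  apply le_antisymm
  · rw [inIdealW, Ideal.span_le]
    rintro _ ⟨f, a, hf, ⟨ha, hlead⟩, rfl⟩
    rw [SetLike.mem_coe]
    have m1 : monomial (ex 2 0 0) (1 : k) ∈ G := by
      rw [mon_eq, hG]; exact Ideal.subset_span (by simp)
    have m2 : monomial (ex 1 1 0) (1 : k) ∈ G := by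
      rw [mon_eq, hG]; exact Ideal.subset_span (by simp)
    have m3 : monomial (ex 1 0 2) (1 : k) ∈ G := by
      rw [mon_eq, hG]; exact Ideal.subset_span (by simp)
    have m4 : monomial (ex 0 4 0) (1 : k) ∈ G := by
      rw [mon_eq, hG]; exact Ideal.subset_span (by simp)
    by_contra hno
    have n1 : ¬ 2 ≤ a 0 := fun h => hno (mon_mem G _ a (by simpa using h) (by simp) (by simp) m1)
    have n2 : ¬ (1 ≤ a 0 ∧ 1 ≤ a 1) := fun h =>
      hno (mon_mem G _ a (by simpa using h.1) (by simpa using h.2) (by simp) m2)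
    have n3 : ¬ (1 ≤ a 0 ∧ 2 ≤ a 2) := fun h =>
      hno (mon_mem G _ a (by simpa using h.1) (by simp) (by simpa using h.2) m3)
    have n4 : ¬ 4 ≤ a 1 := fun h => hno (mon_mem G _ a (by simp) (by simpa using h) (by simp) m4)
    set f' := homogeneousComponent a.degree f with hf'
    have hf'mem : f' ∈ actI g I := actI_homog_s17 I hI g f hf _
    have hf'a : coeff a f' ≠ 0 := by
      rw [hf', coeff_homogeneousComponent, if_pos rfl]
      exact mem_support_iff.1 ha
    have hsupp : ∀ e, coeff e f' ≠ 0 → e 0 + e 1 + e 2 = a 0 + a 1 + a 2 ∧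
        (e = a ∨ lexlt e a) := by
      intro e he
      rw [hf', coeff_homogeneousComponent] at he
      split_ifs at he with h
      · rw [deg3, deg3] at h
        refine ⟨h, ?_⟩
        by_cases hea : e = a
        · exact Or.inl hea
        · exact Or.inr (hlead e (mem_support_iff.2 he) hea)
      · exact absurd rfl he
    have hfin : ∀ (s : Fin 3 →₀ ℕ) (b : Fin 4 → (Fin 3 →₀ ℕ)), Function.Injective b →
        Hind (fun i => psi g.adjugate (monomial (b i) 1)) →
        (∀ e, coeff e f' ≠ 0 → ∃ i, b i = s + e) → False := by
      intro s b hinj hb hs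
      have h0 : monomial s 1 * f' = 0 := by
        refine low_zero I hI g b hinj hb _ (Ideal.mul_mem_left _ _ hf'mem) ?_
        intro e he
        rw [coeff_monomial_mul'] at he
        split_ifs at he with h
        · rw [one_mul] at he
          obtain ⟨i, hi⟩ := hs _ he
          exact ⟨i, by rw [hi, add_tsub_cancel_of_le h]⟩
        · exact absurd rfl he
      apply hf'a
      have h1 := congrArg (coeff (s + a)) h0
      rwa [coeff_monomial_mul, one_mul, coeff_zero] at h1
    rcases Nat.lt_or_ge (a 0) 1 with ha0 | ha0
    · refine hfin (ex 0 0 3) (b3 (a 1 + a 2)) (b3_inj _) (hind_b3 _ hd _) ?_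
      intro e he
      obtain ⟨h1, h2⟩ := hsupp e he
      have h3 : e 0 = 0 ∧ e 1 ≤ 3 := by
        rcases h2 with rfl | h2
        · omega
        · rw [lexlt3] at h2; omega
      refine ⟨⟨e 1, by omega⟩, ?_⟩
      apply ex_ext <;> simp [b3] <;> omega
    · refine hfin (ex 0 0 (1 - a 2)) b2 b2_inj (hind_b2 _ hd) ?_
      intro e he
      obtain ⟨h1, h2⟩ := hsupp e he
      have h3 : (e 0 = 1 ∧ e 1 = 0 ∧ e 2 = a 2) ∨ (e 0 = 0 ∧ e 1 + e 2 = 1 + a 2) := by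
        rcases h2 with rfl | h2
        · omega
        · rw [lexlt3] at h2; omega
      rcases h3 with ⟨e0, e1, e2⟩ | ⟨e0, e12⟩
      · refine ⟨0, ?_⟩
        apply ex_ext <;> simp [b2] <;> omega
      · have hle : e 1 ≤ 2 := by omega
        interval_cases h : e 1
        · refine ⟨3, ?_⟩
          apply ex_ext <;> simp [b2] <;> omega
        · refine ⟨2, ?_⟩
          apply ex_ext <;> simp [b2] <;> omega
        · refine ⟨1, ?_⟩
          apply ex_ext <;> simp [b2] <;> omega
  · have m1 := gen_mem I hI g hg 0 b2 (hind_b2 _ hd) deg_b2 (ex 2 0 0) (by simp [deg3])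
      (by intro i; rw [lexlt3]; fin_cases i <;> simp [b2])
    have m2 := gen_mem I hI g hg 0 b2 (hind_b2 _ hd) deg_b2 (ex 1 1 0) (by simp [deg3])
      (by intro i; rw [lexlt3]; fin_cases i <;> simp [b2])
    have m3 := gen_mem I hI g hg 1 (b3 0) (hind_b3 _ hd _) (deg_b3 0) (ex 1 0 2) (by simp [deg3])
      (by intro i; rw [lexlt3]; simp [b3])
    have m4 := gen_mem I hI g hg 2 (b3 1) (hind_b3 _ hd _) (deg_b3 1) (ex 0 4 0) (by simp [deg3])
      (by intro i; rw [lexlt3]; exact Or.inr (Or.inl ⟨rfl, i.2⟩))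
    rw [mon_eq] at m1 m2 m3 m4
    simp only [ex_0, ex_1, ex_2, pow_zero, pow_one, mul_one, one_mul] at m1 m2 m3 m4
    rw [hG, Ideal.span_le]
    rintro _ (rfl | rfl | rfl | rfl)
    · exact m1
    · exact m2
    · exact m3
    · exact m4

theorem disc_ex : disc (!![1, 0, 0; 0, 1, 1; 0, 0, 1] : Matrix (Fin 3) (Fin 3) k) ≠ 0 := by
  have p0 : pp (!![1, 0, 0; 0, 1, 1; 0, 0, 1] : Matrix (Fin 3) (Fin 3) k) 0 =
    Polynomial.X ^ 2 := by simp [pp]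
  have p1 : pp (!![1, 0, 0; 0, 1, 1; 0, 0, 1] : Matrix (Fin 3) (Fin 3) k) 1 =
    Polynomial.X := by simp [pp]
  have p2 : pp (!![1, 0, 0; 0, 1, 1; 0, 0, 1] : Matrix (Fin 3) (Fin 3) k) 2 =
    1 + Polynomial.X := by simp [pp]
  have q2 : (1 + Polynomial.X : Polynomial k) ^ 2 =
      Polynomial.C 1 + Polynomial.C 2 * Polynomial.X + Polynomial.X ^ 2 := by
    simp only [map_one, map_ofNat]; ring
  have q3 : (1 + Polynomial.X : Polynomial k) ^ 3 =
      Polynomial.C 1 + Polynomial.C 3 * Polynomial.X + Polynomial.C 3 * Polynomial.X ^ 2 +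
        Polynomial.X ^ 3 := by
    simp only [map_one, map_ofNat]; ring
  have q12 : (Polynomial.X : Polynomial k) * (1 + Polynomial.X) ^ 2 =
      Polynomial.X + Polynomial.C 2 * Polynomial.X ^ 2 + Polynomial.X ^ 3 := by
    simp only [map_ofNat]; ring
  have q21 : (Polynomial.X : Polynomial k) ^ 2 * (1 + Polynomial.X) =
      Polynomial.X ^ 2 + Polynomial.X ^ 3 := by ring
  have q11 : (Polynomial.X : Polynomial k) * (1 + Polynomial.X) =
      Polynomial.X + Polynomial.X ^ 2 := by ring
  have d2 : cmat (w2 (!![1, 0, 0; 0, 1, 1; 0, 0, 1] : Matrix (Fin 3) (Fin 3) k)) =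
      !![0, 0, 1, 1; 0, 0, 1, 0; 0, 1, 1, 0; 1, 2, 1, 0] := by
    ext i j
    fin_cases i <;> simp only [cmat, w2, p0, p1, p2, Matrix.of_apply, q2, q21, q11,
      Fin.reduceFinMk, Matrix.cons_val] <;> fin_cases j <;>
      simp [Polynomial.coeff_X, Polynomial.coeff_X_pow, Polynomial.coeff_one]
  have d3 : cmat (w3 (!![1, 0, 0; 0, 1, 1; 0, 0, 1] : Matrix (Fin 3) (Fin 3) k)) =
      !![1, 3, 3, 1; 0, 1, 2, 1; 0, 0, 1, 1; 0, 0, 0, 1] := by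
    ext i j
    fin_cases i <;> simp [cmat, w3, p1, p2, q3, q12, q21] <;> fin_cases j <;>
      simp [Polynomial.coeff_X, Polynomial.coeff_X_pow, Polynomial.coeff_one]
  rw [disc, d2, d3]
  simp [Matrix.det_succ_row_zero, Fin.sum_univ_succ, Fin.succAbove]

theorem gin_I (I G : Ideal (MvPolynomial (Fin 3) k))
    (hI : I = Ideal.span {X 0 ^ 2, X 0 * X 2 - X 1 ^ 2})
    (hG : G = Ideal.span {X 0 ^ 2, X 0 * X 1, X 0 * X 2 ^ 2, X 1 ^ 4}) :
    IsGinW lexlt I G := by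
  have heval : ∀ g : Matrix (Fin 3) (Fin 3) k,
      MvPolynomial.eval (fun q => g q.1 q.2)
        (disc (Matrix.mvPolynomialX (Fin 3) (Fin 3) k).adjugate) = disc g.adjugate := by
    intro g
    rw [← disc_map, RingHom.map_adjugate]
    congr 2
    ext i j
    simp [Matrix.mvPolynomialX]
  refine ⟨{g | IsUnit g.det ∧ ∃ p ∈ ({disc (Matrix.mvPolynomialX (Fin 3) (Fin 3) k).adjugate} :
    Set (MvPolynomial (Fin 3 × Fin 3) k)), MvPolynomial.eval (fun q => g q.1 q.2) p ≠ 0},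
    ?_, ⟨_, rfl⟩, ?_⟩
  · refine ⟨!![1, 0, 0; 0, 1, -1; 0, 0, 1], ?_, _, rfl, ?_⟩
    · simp [Matrix.det_fin_three]
    · rw [heval]
      have : (!![1, 0, 0; 0, 1, -1; 0, 0, 1] : Matrix (Fin 3) (Fin 3) k).adjugate =
          !![1, 0, 0; 0, 1, 1; 0, 0, 1] := by
        rw [Matrix.adjugate_fin_three]
        ext i j
        fin_cases i <;> fin_cases j <;> simp
      rw [this]
      exact disc_ex
  · rintro g ⟨hg, p, rfl, hp⟩
    rw [heval] at hp
    exact in_eq I G hI hG g hg hp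

end GinFinal


/-- The example of Section 4: in `S = k[x₁,x₂,x₃]` with `char k = 0` and the
lexicographic order, for `I = (x₁², x₁x₃ - x₂²)` one has
`gin(I) = (x₁², x₁x₂, x₁x₃², x₂⁴)`, `r(S/I) = 2` and `r(S/gin(I)) = 3 > r(S/I)`;
so Theorem 4.3 fails for the lexicographic order. -/
theorem statement17 {k : Type*} [Field k] [CharZero k]
    (I G : Ideal (MvPolynomial (Fin 3) k))
    (hIdef : I = Ideal.span {X 0 ^ 2, X 0 * X 2 - X 1 ^ 2})
    (hGdef : G = Ideal.span {X 0 ^ 2, X 0 * X 1, X 0 * X 2 ^ 2, X 1 ^ 4}) :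
    IsGinW lexlt I G ∧
    ringRedNum (maxIdealQ I) = 2 ∧
    ringRedNum (maxIdealQ G) = 3 ∧
    ringRedNum (maxIdealQ I) < ringRedNum (maxIdealQ G) := by
  exact ⟨gin_I I G hIdef hGdef, redNum_I I hIdef, redNum_G G hGdef, by
    rw [redNum_I I hIdef, redNum_G G hGdef]; norm_num⟩
end
end Paper
end
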